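/- Let ψ(t)=t^{−δ}e^{−αt^r} with δ≥0, α>0, r>0, let β∈ℝ, and let ω be a convex modulus of continuity. Then there exist a constant K>0 (depending only on δ, α, r) and n₀∈ℕ such that for all n≥n₀: |E_n(C^ψ_β H_{ω_C})_C − (2/π)·ψ(n)·e_n(ω)| ≤ K·ψ(n)·γ_n(α,r)·ω(1/n), where γ_n(α,r) = 1/(rαn^r) if 0<r<1, γ_n(α,r) = (1+1/α)e^{−α}/n if r=1, and γ_n(α,r) = e^{−αrn^{r−1}}/n if r>1. -/

import Mathlib

open Real MeasureTheory Filter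

noncomputable section

/-- `ω` is a modulus of continuity: continuous, nondecreasing, subadditive on `[0,∞)`,
nonnegative, and `ω 0 = 0`. -/
def IsModulus (ω : ℝ → ℝ) : Prop :=
  ContinuousOn ω (Set.Ici 0) ∧ MonotoneOn ω (Set.Ici 0) ∧
  (∀ s t : ℝ, 0 ≤ s → 0 ≤ t → ω (s + t) ≤ ω s + ω t) ∧ ω 0 = 0 ∧
  ∀ t : ℝ, 0 ≤ t → 0 ≤ ω t


/-- `T` is a trigonometric polynomial of degree at most `n − 1`. -/
def IsTrigPoly (n : ℕ) (T : ℝ → ℝ) : Prop :=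
  ∃ a b : ℕ → ℝ,
    ∀ x, T x = ∑ k ∈ Finset.range n, (a k * Real.cos (k * x) + b k * Real.sin (k * x))

/-- The kernel `Ψ_β(t) = ∑_{k=1}^∞ ψ(k) cos(kt − βπ/2)`. -/
def PsiKer (ψ : ℝ → ℝ) (β : ℝ) (t : ℝ) : ℝ :=
  ∑' k : ℕ, ψ (k + 1) * Real.cos ((k + 1) * t - β * π / 2)

/-- The class `C^ψ_β H_{ω_C}`. -/
def CClass (ψ : ℝ → ℝ) (β : ℝ) (ω : ℝ → ℝ) : Set (ℝ → ℝ) :=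
  {f | Continuous f ∧ Function.Periodic f (2 * π) ∧
    ∃ a₀ : ℝ, ∃ φ : ℝ → ℝ, Continuous φ ∧ Function.Periodic φ (2 * π) ∧
      (∫ t in (-π)..π, φ t) = 0 ∧
      (∀ t : ℝ, 0 ≤ t → ∀ x h : ℝ, |h| ≤ t → |φ (x + h) - φ x| ≤ ω t) ∧
      ∀ x, f x = a₀ / 2 + (1 / π) * ∫ t in (-π)..π, φ (x - t) * PsiKer ψ β t}

/-- Best uniform approximation of `f` by trigonometric polynomials of degree `≤ n − 1`. -/
def EnC (n : ℕ) (f : ℝ → ℝ) : ℝ :=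
  sInf {e | ∃ T : ℝ → ℝ, IsTrigPoly n T ∧ e = ⨆ x : ℝ, |f x - T x|}

/-- Best uniform approximation of a class of functions. -/
def EnCClass (n : ℕ) (N : Set (ℝ → ℝ)) : ℝ := sSup (EnC n '' N)

/-- `e_n(ω) = ∫_0^{π/2} ω(2t/n) sin t dt`. -/
def eN (n : ℕ) (ω : ℝ → ℝ) : ℝ := ∫ t in (0:ℝ)..(π / 2), ω (2 * t / n) * Real.sin t


/-- `γ_n(α,r)` from Corollary 1. -/
def gammaAR (α r : ℝ) (n : ℕ) : ℝ :=
  if r < 1 then 1 / (r * α * (n : ℝ) ^ r)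
  else if r = 1 then (1 + 1 / α) * Real.exp (-α) / n
  else Real.exp (-α * r * (n : ℝ) ^ (r - 1)) / n

/-- `ψ(t) = t^{−δ} e^{−α t^r}`. -/
def psiDAR (δ α r : ℝ) (t : ℝ) : ℝ := t ^ (-δ) * Real.exp (-α * t ^ r)


open Complex in
lemma alias_exp (n : ℕ) (hn : 0 < n) (l : ℤ) (hl : ¬ ((2 * n : ℤ) ∣ l)) (y : ℝ) :
    ∑ k ∈ Finset.range (2 * n), cexp (I * (l * ((y + k * π / n : ℝ) : ℂ))) = 0 := by
  have hn' : (n : ℂ) ≠ 0 := by exact_mod_cast hn.ne'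
  set w : ℂ := cexp (I * (l * (π / n))) with hw
  have h1 : ∀ k : ℕ, cexp (I * (l * ((y + k * π / n : ℝ) : ℂ))) = cexp (I * (l * y)) * w ^ k := by
    intro k
    rw [hw, ← Complex.exp_nat_mul, ← Complex.exp_add]
    congr 1
    push_cast
    ring
  simp_rw [h1]
  rw [← Finset.mul_sum]
  have hw1 : w ≠ 1 := by
    intro h
    rw [hw, Complex.exp_eq_one_iff] at h
    obtain ⟨m, hm⟩ := h
    apply hl
    refine ⟨m, ?_⟩
    have hpi : (π : ℂ) ≠ 0 := by exact_mod_cast Real.pi_ne_zero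
    have : (l : ℂ) = 2 * n * m := by
      field_simp at hm
      linear_combination hm
    exact_mod_cast this
  have hw2 : w ^ (2 * n) = 1 := by
    rw [hw, ← Complex.exp_nat_mul, Complex.exp_eq_one_iff]
    refine ⟨l, ?_⟩
    push_cast
    field_simp
  rw [geom_sum_eq hw1, hw2]
  simp

open Complex in
lemma alias_alt_exp (n : ℕ) (hn : 0 < n) (l : ℤ) (hl : ¬ ((2 * n : ℤ) ∣ l + n)) (y : ℝ) :
    ∑ k ∈ Finset.range (2 * n), (-1 : ℂ) ^ k * cexp (I * (l * ((y + k * π / n : ℝ) : ℂ))) = 0 := by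
  have hn' : (n : ℂ) ≠ 0 := by exact_mod_cast hn.ne'
  have h := alias_exp n hn (l + n) hl y
  have h1 : ∀ k : ℕ, (-1 : ℂ) ^ k * cexp (I * (l * ((y + k * π / n : ℝ) : ℂ)))
      = cexp (-(I * (n * y))) * cexp (I * ((l + n : ℤ) * ((y + k * π / n : ℝ) : ℂ))) := by
    intro k
    rw [← Complex.exp_pi_mul_I, ← Complex.exp_nat_mul, ← Complex.exp_add, ← Complex.exp_add]
    congr 1
    push_cast
    field_simp
    ring
  simp_rw [h1]
  rw [← Finset.mul_sum, h, mul_zero]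

lemma cos_eq_re (l : ℤ) (x θ : ℝ) : Real.cos (l * x - θ) =
    (Complex.exp (-(Complex.I * θ)) * Complex.exp (Complex.I * (l * (x : ℂ)))).re := by
  rw [← Complex.exp_add]
  have : -(Complex.I * θ) + Complex.I * (l * (x : ℂ)) = ((l * x - θ : ℝ) : ℂ) * Complex.I := by
    push_cast; ring
  rw [this, Complex.exp_ofReal_mul_I_re]

lemma alias_cos (n : ℕ) (hn : 0 < n) (l : ℤ) (hl : ¬ ((2 * n : ℤ) ∣ l)) (y θ : ℝ) :
    ∑ k ∈ Finset.range (2 * n), Real.cos (l * (y + k * π / n) - θ) = 0 := by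
  simp_rw [cos_eq_re]
  rw [← Complex.re_sum, ← Finset.mul_sum, alias_exp n hn l hl y]
  simp

lemma alias_alt_cos (n : ℕ) (hn : 0 < n) (l : ℤ) (hl : ¬ ((2 * n : ℤ) ∣ l + n)) (y θ : ℝ) :
    ∑ k ∈ Finset.range (2 * n), (-1 : ℝ) ^ k * Real.cos (l * (y + k * π / n) - θ) = 0 := by
  have h1 : ∀ k : ℕ, (-1 : ℝ) ^ k * Real.cos (l * (y + k * π / n) - θ) =
    (Complex.exp (-(Complex.I * θ)) * ((-1 : ℂ) ^ k *
      Complex.exp (Complex.I * (l * ((y + k * π / n : ℝ) : ℂ))))).re := by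
    intro k
    rw [cos_eq_re]
    have : ((-1 : ℂ) ^ k) = (((-1 : ℝ) ^ k : ℝ) : ℂ) := by push_cast; rfl
    rw [this, mul_left_comm (Complex.exp _), Complex.re_ofReal_mul]
  simp_rw [h1]
  rw [← Complex.re_sum, ← Finset.mul_sum, alias_alt_exp n hn l hl y]
  simp

/-- complex trigonometric polynomials of degree at most `d` -/
def TP (d : ℕ) : Submodule ℂ (ℝ → ℂ) :=
  Submodule.span ℂ {f | ∃ l : ℤ, |l| ≤ d ∧ f = fun x : ℝ => Complex.exp (Complex.I * (l * (x : ℂ)))}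

lemma TP_exp (d : ℕ) (l : ℤ) (hl : |l| ≤ d) :
    (fun x : ℝ => Complex.exp (Complex.I * (l * (x : ℂ)))) ∈ TP d :=
  Submodule.subset_span ⟨l, hl, rfl⟩

lemma TP_shift (d : ℕ) (q : ℝ → ℂ) (hq : q ∈ TP d) (a : ℝ) : (fun x => q (x + a)) ∈ TP d := by
  unfold TP at hq
  induction hq using Submodule.span_induction with
  | mem f hf =>
    obtain ⟨l, hl, rfl⟩ := hf
    have : (fun x : ℝ => Complex.exp (Complex.I * (l * ((x + a : ℝ) : ℂ)))) =
      Complex.exp (Complex.I * (l * a)) • fun x : ℝ => Complex.exp (Complex.I * (l * (x : ℂ))) := by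
      funext x
      simp only [Pi.smul_apply, smul_eq_mul]
      rw [← Complex.exp_add]
      congr 1
      push_cast
      ring
    rw [this]
    exact Submodule.smul_mem _ _ (TP_exp d l hl)
  | zero => exact Submodule.zero_mem _
  | add f g _ _ hf hg => exact Submodule.add_mem _ hf hg
  | smul c f _ hf => exact Submodule.smul_mem _ c hf

lemma TP_mul (d e : ℕ) (q p : ℝ → ℂ) (hq : q ∈ TP d) (hp : p ∈ TP e) : q * p ∈ TP (d + e) := by
  have h : TP d * TP e ≤ TP (d + e) := by
    unfold TP
    rw [Submodule.span_mul_span]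
    apply Submodule.span_mono
    rintro _ ⟨f, ⟨l, hl, rfl⟩, g, ⟨m, hm, rfl⟩, rfl⟩
    refine ⟨l + m, ?_, ?_⟩
    · push_cast
      exact (abs_add_le l m).trans (add_le_add hl hm)
    · funext x
      simp only [Pi.mul_apply]
      rw [← Complex.exp_add]
      congr 1
      push_cast
      ring
  exact h (Submodule.mul_mem_mul hq hp)

lemma TP_alt (n d : ℕ) (hd : d < n) (q : ℝ → ℂ) (hq : q ∈ TP d) (y : ℝ) :
    ∑ k ∈ Finset.range (2 * n), (-1 : ℂ) ^ k * q (y + k * π / n) = 0 := by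
  unfold TP at hq
  induction hq using Submodule.span_induction with
  | mem f hf =>
    obtain ⟨l, hl, rfl⟩ := hf
    apply alias_alt_exp n (by omega)
    rintro ⟨c, hc⟩
    have h1 := abs_le.1 hl
    have h2 : 0 < 2 * (n : ℤ) * c := by omega
    have h3 : 2 * (n : ℤ) * c < 2 * n * 1 := by omega
    have h4 : c < 1 := lt_of_mul_lt_mul_left h3 (by omega)
    have h5 : 0 < c := pos_of_mul_pos_right h2 (by omega)
    omega
  | zero => simp
  | add f g _ _ hf hg => simp [mul_add, Finset.sum_add_distrib, hf, hg]
  | smul c f _ hf =>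
    simp only [Pi.smul_apply, smul_eq_mul, mul_left_comm _ c]
    rw [← Finset.mul_sum, hf, mul_zero]

lemma TP_cos (j : ℕ) (d : ℕ) (h : j ≤ d) : (fun x : ℝ => ((Real.cos (j * x) : ℝ) : ℂ)) ∈ TP d := by
  have : (fun x : ℝ => ((Real.cos (j * x) : ℝ) : ℂ)) =
    (1 / 2 : ℂ) • ((fun x : ℝ => Complex.exp (Complex.I * ((j : ℤ) * (x : ℂ)))) +
     (fun x : ℝ => Complex.exp (Complex.I * ((-j : ℤ) * (x : ℂ))))) := by
    funext x
    simp only [Pi.smul_apply, Pi.add_apply, smul_eq_mul]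
    push_cast
    rw [Complex.cos]
    ring_nf
  rw [this]
  refine Submodule.smul_mem _ _ (Submodule.add_mem _ (TP_exp d _ ?_) (TP_exp d _ ?_))
  · simpa using h
  · simpa using h

/-- exponential sum -/
def ES (a : ℕ → ℂ) (N : ℕ) (x : ℝ) : ℂ :=
  ∑ j ∈ Finset.range N, a j * Complex.exp (Complex.I * (((j : ℕ) : ℤ) * (x : ℂ)))

lemma ES_sq (a : ℕ → ℂ) (N : ℕ) (x : ℝ) : ((‖ES a N x‖ ^ 2 : ℝ) : ℂ) =
    ∑ i ∈ Finset.range N, ∑ j ∈ Finset.range N, (a i * (starRingEnd ℂ) (a j)) *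
      Complex.exp (Complex.I * (((i : ℤ) - (j : ℤ) : ℤ) * (x : ℂ))) := by
  have : ((‖ES a N x‖ ^ 2 : ℝ) : ℂ) = ES a N x * (starRingEnd ℂ) (ES a N x) := by
    rw [Complex.mul_conj, Complex.normSq_eq_norm_sq]
  rw [this]
  unfold ES
  rw [map_sum, Finset.sum_mul_sum]
  refine Finset.sum_congr rfl fun i _ => Finset.sum_congr rfl fun j _ => ?_
  rw [map_mul, ← Complex.exp_conj, mul_mul_mul_comm, ← Complex.exp_add]
  congr 2
  simp
  ring

lemma parseval (n : ℕ) (hn : 0 < n) (a : ℕ → ℂ) (N : ℕ) (hN : N ≤ 2 * n) (y : ℝ) :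
    ∑ k ∈ Finset.range (2 * n), ‖ES a N (y + k * π / n)‖ ^ 2 =
      2 * n * ∑ j ∈ Finset.range N, ‖a j‖ ^ 2 := by
  have h : ((∑ k ∈ Finset.range (2 * n), ‖ES a N (y + k * π / n)‖ ^ 2 : ℝ) : ℂ) =
     ((2 * n * ∑ j ∈ Finset.range N, ‖a j‖ ^ 2 : ℝ) : ℂ) := by
    rw [Complex.ofReal_sum]
    simp_rw [ES_sq]
    rw [Finset.sum_comm]
    push_cast
    rw [Finset.mul_sum]
    refine Finset.sum_congr rfl fun i hi => ?_
    rw [Finset.sum_comm]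
    rw [Finset.sum_eq_single i]
    · simp
      rw [Complex.mul_conj, Complex.normSq_eq_norm_sq]
      left
      push_cast; ring
    · intro j hj hji
      rw [← Finset.mul_sum]
      have := alias_exp n hn ((i : ℤ) - j) ?_ y
      · push_cast at this ⊢
        rw [this, mul_zero]
      · rintro ⟨c, hc⟩
        have hi' := Finset.mem_range.1 hi
        have hj' := Finset.mem_range.1 hj
        have h3 : 2 * (n : ℤ) * c < 2 * n * 1 := by omega
        have h4 : c < 1 := lt_of_mul_lt_mul_left h3 (by omega)
        have h5 : 2 * (n : ℤ) * (-1) < 2 * n * c := by omega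
        have h6 : -1 < c := lt_of_mul_lt_mul_left h5 (by omega)
        have h7 : c = 0 := by omega
        rw [h7] at hc
        omega
    · intro h; exact absurd hi h
  exact_mod_cast h

lemma mod_nat (ω : ℝ → ℝ) (hω : IsModulus ω) (k : ℕ) (s : ℝ) (hs : 0 ≤ s) :
    ω (k * s) ≤ k * ω s := by
  obtain ⟨_, _, hsub, h0, _⟩ := hω
  induction k with
  | zero => simp [h0]
  | succ k ih =>
    push_cast
    rw [add_mul, one_mul, add_mul, one_mul]
    have := hsub (k * s) s (by positivity) hs
    linarith

lemma mod_le (ω : ℝ → ℝ) (hω : IsModulus ω) (n : ℕ) (hn : 0 < n) (t : ℝ) (ht : 0 ≤ t) :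
    ω t ≤ (1 + n * t) * ω (1 / n) := by
  have hn' : (0 : ℝ) < n := by exact_mod_cast hn
  have h1 := mod_nat ω hω (⌊n * t⌋₊ + 1) (1 / n) (by positivity)
  have h2 : t ≤ (⌊n * t⌋₊ + 1 : ℕ) * (1 / n : ℝ) := by
    push_cast
    rw [mul_one_div, le_div_iff₀ hn', mul_comm]
    exact (Nat.lt_floor_add_one _).le
  have h3 := hω.2.1 (Set.mem_Ici.2 ht) (Set.mem_Ici.2 (ht.trans h2)) h2
  have h4 : 0 ≤ ω (1 / n) := hω.2.2.2.2 _ (by positivity)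
  have h5 : ((⌊n * t⌋₊ + 1 : ℕ) : ℝ) ≤ 1 + n * t := by
    push_cast
    have := Nat.floor_le (show 0 ≤ n * t by positivity)
    linarith
  calc ω t ≤ _ := h3
    _ ≤ _ := h1
    _ ≤ _ := mul_le_mul_of_nonneg_right h5 h4

/-- `h` has modulus of continuity at most `ω` -/
def HasMod (ω h : ℝ → ℝ) : Prop := ∀ t : ℝ, 0 ≤ t → ∀ x v : ℝ, |v| ≤ t → |h (x + v) - h x| ≤ ω t

lemma h_bound (ω h : ℝ → ℝ) (hω : IsModulus ω) (hh : HasMod ω h) (hp : Function.Periodic h (2 * π))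
    (n : ℕ) (hn : 0 < n) (z x : ℝ) :
    |h z - h x| ≤ ω (1 / n) * (2 + 5 * n ^ 2 * (1 - Real.cos (z - x))) := by
  have hn' : (0 : ℝ) < n := by exact_mod_cast hn
  have hpi := Real.pi_pos
  set k : ℤ := round ((z - x) / (2 * π)) with hk
  set s : ℝ := z - x - k * (2 * π) with hs
  have hs1 : |s| ≤ π := by
    have h1 := abs_sub_round ((z - x) / (2 * π))
    rw [← hk] at h1
    have : s = ((z - x) / (2 * π) - k) * (2 * π) := by rw [hs]; field_simp
    rw [this, abs_mul, abs_of_pos (by positivity : 0 < 2 * π)]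
    nlinarith
  have hz : h z = h (x + s) := by
    have : x + s = z - k * (2 * π) := by rw [hs]; ring
    rw [this, hp.sub_int_mul_eq]
  have hc : Real.cos (z - x) = Real.cos s := by
    rw [hs, Real.cos_sub_int_mul_two_pi]
  have h1 : |h z - h x| ≤ ω |s| := by
    rw [hz]; exact hh _ (abs_nonneg _) x s le_rfl
  have h2 := mod_le ω hω n hn |s| (abs_nonneg _)
  have h4 : 0 ≤ ω (1 / n) := hω.2.2.2.2 _ (by positivity)
  have h5 : s ^ 2 ≤ 5 * (1 - Real.cos s) := by
    have h6 := Real.cos_le_one_sub_mul_cos_sq hs1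
    have h8 : 2 / π ^ 2 * s ^ 2 ≤ 1 - Real.cos s := by linarith
    have h9 : s ^ 2 = (2 / π ^ 2 * s ^ 2) * (π ^ 2 / 2) := by field_simp
    have h10 : π ^ 2 / 2 ≤ 5 := by nlinarith [Real.pi_lt_d2]
    have h11 : 0 ≤ 1 - Real.cos s := by linarith [Real.cos_le_one s]
    rw [h9]
    nlinarith [show 0 < π ^ 2 / 2 by positivity]
  rw [hc]
  have h6 : 1 + n * |s| ≤ 2 + 5 * n ^ 2 * (1 - Real.cos s) := by
    have h7 : (n * |s|) ^ 2 = n ^ 2 * s ^ 2 := by rw [mul_pow, sq_abs]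
    nlinarith [sq_nonneg (n * |s| - 1), mul_le_mul_of_nonneg_left h5 (sq_nonneg (n : ℝ)), sq_nonneg (n * |s|)]
  calc |h z - h x| ≤ _ := h1
    _ ≤ _ := h2
    _ ≤ _ := by rw [mul_comm]; exact mul_le_mul_of_nonneg_left h6 h4

/-- coefficients of the Jackson type kernel -/
def ja (N : ℕ) (j : ℕ) : ℂ := (((j + 1) * (N - j) : ℝ) : ℂ)
/-- differences -/
def jb (N : ℕ) (j : ℕ) : ℂ := ((N - 2 * j : ℝ) : ℂ)

lemma jab (N : ℕ) (x : ℝ) : ES (jb N) (N + 1) x =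
    (1 - Complex.exp (Complex.I * x)) * ES (ja N) N x := by
  have key : ∀ M : ℕ, ES (jb N) (M + 1) x = (1 - Complex.exp (Complex.I * x)) * ES (ja N) M x
      + ja N M * Complex.exp (Complex.I * (((M : ℕ) : ℤ) * (x : ℂ))) := by
    intro M
    induction M with
    | zero => simp [ES, ja, jb]
    | succ M ih =>
      have e1 : ES (jb N) (M + 1 + 1) x = ES (jb N) (M + 1) x + jb N (M + 1) *
        Complex.exp (Complex.I * (((M + 1 : ℕ) : ℤ) * (x : ℂ))) := Finset.sum_range_succ _ _
      have e2 : ES (ja N) (M + 1) x = ES (ja N) M x + ja N M *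
        Complex.exp (Complex.I * (((M : ℕ) : ℤ) * (x : ℂ))) := Finset.sum_range_succ _ _
      rw [e1, ih, e2]
      have e3 : Complex.exp (Complex.I * (((M + 1 : ℕ) : ℤ) * (x : ℂ))) =
        Complex.exp (Complex.I * x) * Complex.exp (Complex.I * (((M : ℕ) : ℤ) * (x : ℂ))) := by
        rw [← Complex.exp_add]; congr 1; push_cast; ring
      rw [e3]
      simp only [ja, jb]
      push_cast
      ring
  rw [key N]
  simp [ja]

lemma ja_sum (N : ℕ) : (N : ℝ) * (N + 1) ^ 2 * (N + 2) ^ 2 / 36 ≤ ∑ j ∈ Finset.range N, ‖ja N j‖ ^ 2 := by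
  have h1 : ∀ M : ℕ, ∑ j ∈ Finset.range M, ((j + 1) * (N - j) : ℝ) =
      N * M * (M + 1) / 2 - (M - 1) * M * (M + 1) / 3 := by
    intro M
    induction M with
    | zero => simp
    | succ M ih => rw [Finset.sum_range_succ, ih]; push_cast; ring
  have h2 : ∀ j, ‖ja N j‖ ^ 2 = ((j + 1) * (N - j) : ℝ) ^ 2 := by
    intro j
    rw [ja, Complex.norm_real, Real.norm_eq_abs, sq_abs]
  simp_rw [h2]
  have h3 := sq_sum_le_card_mul_sum_sq (s := Finset.range N) (f := fun j : ℕ => ((j + 1) * (N - j) : ℝ))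
  rw [h1, Finset.card_range] at h3
  rcases Nat.eq_zero_or_pos N with rfl | hN
  · simp
  · have hN' : (0 : ℝ) < N := by exact_mod_cast hN
    refine le_of_mul_le_mul_left (le_trans (le_of_eq ?_) h3) hN'
    ring

lemma jb_sum (N : ℕ) : ∑ j ∈ Finset.range (N + 1), ‖jb N j‖ ^ 2 ≤ (N + 1) * (N : ℝ) ^ 2 := by
  have : ∀ j ∈ Finset.range (N + 1), ‖jb N j‖ ^ 2 ≤ (N : ℝ) ^ 2 := by
    intro j hj
    have hj' : (j : ℝ) ≤ N := by exact_mod_cast Nat.lt_succ_iff.1 (Finset.mem_range.1 hj)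
    have hj0 : (0 : ℝ) ≤ j := by positivity
    rw [jb, Complex.norm_real, Real.norm_eq_abs, sq_abs]
    nlinarith
  refine (Finset.sum_le_card_nsmul _ _ _ this).trans (le_of_eq ?_)
  simp

lemma norm_one_sub (x : ℝ) : ‖1 - Complex.exp (Complex.I * x)‖ ^ 2 = 2 * (1 - Real.cos x) := by
  rw [← Complex.normSq_eq_norm_sq, mul_comm, Complex.exp_mul_I, Complex.normSq_apply]
  have h1 : (1 - (Complex.cos x + Complex.sin x * Complex.I)).re = 1 - Real.cos x := by
    simp [← Complex.ofReal_cos, ← Complex.ofReal_sin]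
  have h2 : (1 - (Complex.cos x + Complex.sin x * Complex.I)).im = - Real.sin x := by
    simp [← Complex.ofReal_cos, ← Complex.ofReal_sin]
  rw [h1, h2]
  nlinarith [Real.sin_sq_add_cos_sq x]

lemma TP_ES (a : ℕ → ℂ) (N : ℕ) (z : ℝ) :
    (fun x : ℝ => ((‖ES a N (z - x)‖ ^ 2 : ℝ) : ℂ)) ∈ TP N := by
  have : (fun x : ℝ => ((‖ES a N (z - x)‖ ^ 2 : ℝ) : ℂ)) =
    ∑ i ∈ Finset.range N, ∑ j ∈ Finset.range N, (a i * (starRingEnd ℂ) (a j) *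
      Complex.exp (Complex.I * (((i : ℤ) - (j : ℤ) : ℤ) * (z : ℂ)))) •
      (fun x : ℝ => Complex.exp (Complex.I * (((j : ℤ) - (i : ℤ) : ℤ) * (x : ℂ)))) := by
    funext x
    rw [ES_sq, Finset.sum_apply]
    refine Finset.sum_congr rfl fun i _ => ?_
    rw [Finset.sum_apply]
    refine Finset.sum_congr rfl fun j _ => ?_
    simp only [Pi.smul_apply, smul_eq_mul]
    rw [mul_assoc (a i * (starRingEnd ℂ) (a j)), ← Complex.exp_add]
    congr 2
    push_cast
    ring
  rw [this]
  refine Submodule.sum_mem _ fun i hi => Submodule.sum_mem _ fun j hj => Submodule.smul_mem _ _ (TP_exp _ _ ?_)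
  have := Finset.mem_range.1 hi
  have := Finset.mem_range.1 hj
  rw [abs_le]; omega

lemma jackson (ω h : ℝ → ℝ) (hω : IsModulus ω) (hh : HasMod ω h) (hp : Function.Periodic h (2 * π))
    (n N : ℕ) (hN : 0 < N) (hNn : N < 2 * n) (hn : n ≤ 4 * N) :
    ∃ p ∈ TP N, ∀ x, ‖(h x : ℂ) - p x‖ ≤ 1500 * ω (1 / n) := by
  have hn0 : 0 < n := by omega
  have hn' : (0 : ℝ) < n := by exact_mod_cast hn0
  have hN' : (0 : ℝ) < N := by exact_mod_cast hN
  have h4 : 0 ≤ ω (1 / n) := hω.2.2.2.2 _ (by positivity)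
  set A : ℝ := ∑ j ∈ Finset.range N, ‖ja N j‖ ^ 2 with hA
  have hAl := ja_sum N
  rw [← hA] at hAl
  clear_value A
  have hA0 : 0 < A := lt_of_lt_of_le (by positivity) hAl
  set J : ℝ → ℝ := fun s => ‖ES (ja N) N s‖ ^ 2 with hJ
  refine ⟨∑ k ∈ Finset.range (2 * n), ((h (k * π / n) / (2 * n * A) : ℝ) : ℂ) •
    (fun x : ℝ => ((J (k * π / n - x) : ℝ) : ℂ)), ?_, ?_⟩
  · exact Submodule.sum_mem _ fun k _ => Submodule.smul_mem _ _ (TP_ES _ _ _)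
  · intro x
    have e1 : ∑ k ∈ Finset.range (2 * n), J (-x + k * π / n) = 2 * n * A := by
      rw [hA]; exact parseval n hn0 _ _ hNn.le _
    have e2 : ∑ k ∈ Finset.range (2 * n), 2 * (1 - Real.cos (-x + k * π / n)) * J (-x + k * π / n) ≤
        2 * n * ((N + 1) * (N : ℝ) ^ 2) := by
      have := parseval n hn0 (jb N) (N + 1) (by omega) (-x)
      simp_rw [jab, norm_mul, mul_pow, norm_one_sub] at this
      rw [this]
      exact mul_le_mul_of_nonneg_left (jb_sum N) (by positivity)
    have e3 : (h x : ℂ) - (∑ k ∈ Finset.range (2 * n), ((h (k * π / n) / (2 * n * A) : ℝ) : ℂ) •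
      (fun x : ℝ => ((J (k * π / n - x) : ℝ) : ℂ))) x =
      (((1 / (2 * n * A)) * ∑ k ∈ Finset.range (2 * n), (h x - h (k * π / n)) * J (-x + k * π / n) : ℝ) : ℂ) := by
      rw [Finset.sum_apply]
      simp only [Pi.smul_apply, smul_eq_mul]
      rw [← Complex.ofReal_inj] at e1
      simp_rw [sub_mul]
      rw [Finset.sum_sub_distrib, ← Finset.mul_sum, mul_sub, Complex.ofReal_sub]
      congr 1
      · rw [Complex.ofReal_inj.1 e1]
        congr 1
        field_simp
      · rw [Finset.mul_sum, Complex.ofReal_sum]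
        refine Finset.sum_congr rfl fun k _ => ?_
        rw [← Complex.ofReal_mul]
        congr 1
        rw [show -x + k * π / n = k * π / n - x by ring]
        ring
    rw [e3, Complex.norm_real, Real.norm_eq_abs, abs_mul, abs_of_pos (by positivity : 0 < 1 / (2 * n * A))]
    have e4 : |∑ k ∈ Finset.range (2 * n), (h x - h (k * π / n)) * J (-x + k * π / n)| ≤
       ω (1 / n) * (2 * (2 * n * A) + 5 * n ^ 2 / 2 * (2 * n * ((N + 1) * (N : ℝ) ^ 2))) := by
      calc _ ≤ ∑ k ∈ Finset.range (2 * n), |(h x - h (k * π / n)) * J (-x + k * π / n)| :=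
            Finset.abs_sum_le_sum_abs _ _
        _ ≤ ∑ k ∈ Finset.range (2 * n), ω (1 / n) * (2 * J (-x + k * π / n) +
            5 * n ^ 2 / 2 * (2 * (1 - Real.cos (-x + k * π / n)) * J (-x + k * π / n))) := by
            refine Finset.sum_le_sum fun k _ => ?_
            have hJ0 : 0 ≤ J (-x + k * π / n) := by rw [hJ]; positivity
            rw [abs_mul, abs_of_nonneg hJ0, abs_sub_comm]
            have := h_bound ω h hω hh hp n hn0 (k * π / n) x
            rw [show k * π / n - x = -x + k * π / n by ring] at this
            refine (mul_le_mul_of_nonneg_right this hJ0).trans (le_of_eq ?_)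
            ring
        _ = ω (1 / n) * (2 * (∑ k ∈ Finset.range (2 * n), J (-x + k * π / n)) + 5 * n ^ 2 / 2 *
             ∑ k ∈ Finset.range (2 * n), 2 * (1 - Real.cos (-x + k * π / n)) * J (-x + k * π / n)) := by
            rw [← Finset.mul_sum, Finset.sum_add_distrib, ← Finset.mul_sum, ← Finset.mul_sum]
        _ ≤ _ := by
            rw [e1]
            gcongr
    refine (mul_le_mul_of_nonneg_left e4 (by positivity)).trans ?_
    rw [one_div_mul_eq_div, div_le_iff₀ (by positivity)]
    have e5 : 5 * (n : ℝ) ^ 2 / 2 * ((N + 1) * (N : ℝ) ^ 2) ≤ 1498 * A := by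
      have hnN : (n : ℝ) ≤ 4 * N := by exact_mod_cast hn
      have hsq : (n : ℝ) ^ 2 ≤ 16 * N ^ 2 := by nlinarith
      have : 5 * (n : ℝ) ^ 2 / 2 * ((N + 1) * (N : ℝ) ^ 2) ≤ 40 * N ^ 2 * ((N + 1) * (N : ℝ) ^ 2) := by
        gcongr; linarith
      refine this.trans (le_trans ?_ (mul_le_mul_of_nonneg_left hAl (by norm_num)))
      have : (N : ℝ) ^ 3 ≤ (N + 1) * (N + 2) ^ 2 := by nlinarith [sq_nonneg (N : ℝ)]
      have h7 := mul_le_mul_of_nonneg_left this (by positivity : (0 : ℝ) ≤ 40 * N * (N + 1))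
      have h8 : 0 ≤ (N : ℝ) * (N + 1) ^ 2 * (N + 2) ^ 2 := by positivity
      nlinarith
    have e6 := mul_le_mul_of_nonneg_left e5 (by positivity : 0 ≤ ω (1 / n) * (2 * n))
    nlinarith

/-- unnormalised Fejer kernels -/
def DD (N : ℕ) (t : ℝ) : ℝ := (∑ j ∈ Finset.range N, Real.cos (j * t)) ^ 2 +
  (∑ j ∈ Finset.range N, Real.sin (j * t)) ^ 2

/-- basic cosines -/
def ww (j : ℕ) (t : ℝ) : ℝ := if j = 0 then 1 else 2 * Real.cos (j * t)

lemma DD_zero (t : ℝ) : DD 0 t = 0 := by simp [DD]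
lemma DD_one (t : ℝ) : DD 1 t = 1 := by simp [DD]
lemma DD_nonneg (N : ℕ) (t : ℝ) : 0 ≤ DD N t := by unfold DD; positivity

lemma DD_at_zero (N : ℕ) : DD N 0 = (N : ℝ) ^ 2 := by simp [DD]

lemma DD_succ (N : ℕ) (t : ℝ) : DD (N + 1) t = DD N t + ∑ j ∈ Finset.range (N + 1), ww j t := by
  have h1 : DD (N + 1) t = DD N t + (1 + 2 * ∑ j ∈ Finset.range N, Real.cos ((N - j : ℝ) * t)) := by
    have : ∑ j ∈ Finset.range N, Real.cos ((N - j : ℝ) * t) =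
        (∑ j ∈ Finset.range N, Real.cos (j * t)) * Real.cos (N * t) +
        (∑ j ∈ Finset.range N, Real.sin (j * t)) * Real.sin (N * t) := by
      rw [Finset.sum_mul, Finset.sum_mul, ← Finset.sum_add_distrib]
      refine Finset.sum_congr rfl fun j _ => ?_
      rw [sub_mul, Real.cos_sub]; ring
    rw [this]
    unfold DD
    rw [Finset.sum_range_succ, Finset.sum_range_succ]
    nlinarith [Real.sin_sq_add_cos_sq (N * t)]
  rw [h1, Finset.sum_range_succ', ← Finset.sum_range_reflect, Finset.mul_sum, add_comm (1 : ℝ)]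
  congr 2
  · refine Finset.sum_congr rfl fun j hj => ?_
    have hj' := Finset.mem_range.1 hj
    have : ((N - 1 - j : ℕ) : ℝ) = N - 1 - j := by
      rw [Nat.cast_sub (by omega), Nat.cast_sub (by omega)]; simp
    rw [this]
    simp only [ww, if_neg (Nat.succ_ne_zero j)]
    push_cast
    ring_nf

lemma abel_DD (c : ℕ → ℝ) (M : ℕ) (t : ℝ) :
    ∑ j ∈ Finset.range (M + 1), (c j - 2 * c (j + 1) + c (j + 2)) * DD (j + 1) t =
    ∑ j ∈ Finset.range (M + 1), c j * ww j t - c (M + 1) * (2 * DD (M + 1) t - DD M t)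
      + c (M + 2) * DD (M + 1) t := by
  induction M with
  | zero => simp [DD_zero, DD_one, ww]; ring
  | succ M ih =>
    rw [Finset.sum_range_succ, ih, Finset.sum_range_succ _ (M + 1)]
    have h2 := DD_succ (M + 1) t
    have h1 := DD_succ M t
    rw [Finset.sum_range_succ] at h2
    have : ww (M + 1) t = DD (M + 2) t - 2 * DD (M + 1) t + DD M t := by linarith
    rw [this]
    ring

/-- the modulating factor -/
def GG (c : ℕ → ℝ) (m : ℕ) (t : ℝ) : ℝ := ∑ j ∈ Finset.range m, c j * ww j t

lemma GG_eq (c : ℕ → ℝ) (m : ℕ) (hm : 0 < m) (hc : ∀ j, m ≤ j → c j = 0) (t : ℝ) :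
    GG c m t = ∑ j ∈ Finset.range m, (c j - 2 * c (j + 1) + c (j + 2)) * DD (j + 1) t := by
  obtain ⟨M, rfl⟩ : ∃ M, m = M + 1 := ⟨m - 1, by omega⟩
  rw [abel_DD, hc (M + 1) (by omega), hc (M + 2) (by omega), GG]
  ring

lemma DD_ES (N : ℕ) (t : ℝ) : DD N t = ‖ES (fun _ => 1) N t‖ ^ 2 := by
  rw [← Complex.normSq_eq_norm_sq, Complex.normSq_apply, DD]
  have h1 : ∀ j : ℕ, (1 : ℂ) * Complex.exp (Complex.I * (((j : ℕ) : ℤ) * (t : ℂ))) =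
      Complex.exp (((j * t : ℝ) : ℂ) * Complex.I) := by
    intro j; rw [one_mul]; congr 1; push_cast; ring
  have hr : (ES (fun _ => 1) N t).re = ∑ j ∈ Finset.range N, Real.cos (j * t) := by
    unfold ES
    rw [Complex.re_sum]
    refine Finset.sum_congr rfl fun j _ => ?_
    rw [h1, Complex.exp_ofReal_mul_I_re]
  have hi : (ES (fun _ => 1) N t).im = ∑ j ∈ Finset.range N, Real.sin (j * t) := by
    unfold ES
    rw [Complex.im_sum]
    refine Finset.sum_congr rfl fun j _ => ?_
    rw [h1, Complex.exp_ofReal_mul_I_im]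
  rw [hr, hi]; ring

lemma DD_var (n : ℕ) (hn : 0 < n) (N : ℕ) (hN : N ≤ 2 * n) (y u : ℝ) (hu : 0 ≤ u) :
    ∑ k ∈ Finset.range (2 * n), |DD N (y + k * π / n + u) - DD N (y + k * π / n - u)| ≤
      8 * n * N ^ 2 * u := by
  set A : ℝ → ℂ := fun s => ES (fun _ => 1) N s with hA
  set b : ℕ → ℂ := fun j => Complex.exp (Complex.I * (((j : ℕ) : ℤ) * (u : ℂ))) -
    Complex.exp (Complex.I * (((j : ℕ) : ℤ) * ((-u : ℝ) : ℂ))) with hb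
  have hAB : ∀ s, A (s + u) - A (s - u) = ES b N s := by
    intro s
    simp only [hA, ES]
    rw [← Finset.sum_sub_distrib]
    refine Finset.sum_congr rfl fun j _ => ?_
    simp only [hb]
    rw [sub_mul, ← Complex.exp_add, ← Complex.exp_add, one_mul, one_mul]
    congr 2
    · push_cast; ring
    · push_cast; ring
  have hbn : ∀ j ∈ Finset.range N, ‖b j‖ ^ 2 ≤ (2 * N * u) ^ 2 := by
    intro j hj
    have hj' : (j : ℝ) ≤ N := by exact_mod_cast (Finset.mem_range.1 hj).le
    have : b j = ((2 * Real.sin (j * u) : ℝ) : ℂ) * Complex.I := by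
      simp only [hb]
      push_cast
      rw [Complex.sin]
      have := Complex.I_mul_I
      ring_nf
      simp
      ring
    rw [this, norm_mul, Complex.norm_I, Complex.norm_real, mul_one, Real.norm_eq_abs, sq_abs]
    have h1 : |Real.sin (j * u)| ≤ |j * u| := Real.abs_sin_le_abs
    have h2 : |(j * u : ℝ)| = j * u := abs_of_nonneg (by positivity)
    rw [h2] at h1
    have h3 : (j : ℝ) * u ≤ N * u := by gcongr
    have h4 : |2 * Real.sin (j * u)| ≤ |2 * N * u| := by
      rw [abs_mul, abs_two, abs_of_nonneg (by positivity : 0 ≤ 2 * N * u)]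
      linarith
    exact sq_le_sq.2 h4
  have hS : ∑ k ∈ Finset.range (2 * n), ‖ES b N (y + k * π / n)‖ ^ 2 ≤ 2 * n * (N * (2 * N * u) ^ 2) := by
    rw [parseval n hn b N hN]
    refine mul_le_mul_of_nonneg_left ?_ (by positivity)
    refine (Finset.sum_le_card_nsmul _ _ _ hbn).trans (le_of_eq (by simp))
  have hA2 : ∀ v : ℝ, ∑ k ∈ Finset.range (2 * n), ‖A (y + k * π / n + v)‖ ^ 2 = 2 * n * N := by
    intro v
    have := parseval n hn (fun _ => 1) N hN (y + v)
    simp only [norm_one, one_pow, Finset.sum_const, Finset.card_range, nsmul_eq_mul, mul_one] at this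
    rw [← this]
    refine Finset.sum_congr rfl fun k _ => ?_
    simp only [hA]
    congr 3
    ring
  have hCS : ∀ v : ℝ, ∑ k ∈ Finset.range (2 * n), ‖ES b N (y + k * π / n)‖ * ‖A (y + k * π / n + v)‖ ≤
      4 * n * N ^ 2 * u := by
    intro v
    have h := Finset.sum_mul_sq_le_sq_mul_sq (Finset.range (2 * n))
      (fun k : ℕ => ‖ES b N (y + k * π / n)‖) (fun k : ℕ => ‖A (y + k * π / n + v)‖)
    rw [hA2] at h
    refine abs_le_of_sq_le_sq' (h.trans ?_) (by positivity) |>.2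
    refine (mul_le_mul_of_nonneg_right hS (by positivity)).trans (le_of_eq ?_)
    ring
  calc _ ≤ ∑ k ∈ Finset.range (2 * n), (‖ES b N (y + k * π / n)‖ * ‖A (y + k * π / n + u)‖ +
        ‖ES b N (y + k * π / n)‖ * ‖A (y + k * π / n + (-u))‖) := by
        refine Finset.sum_le_sum fun k _ => ?_
        rw [DD_ES, DD_ES, ← mul_add, ← hAB, ← sub_eq_add_neg]
        change |‖A _‖ ^ 2 - ‖A _‖ ^ 2| ≤ _
        rw [sq_sub_sq, abs_mul, mul_comm, abs_of_nonneg (by positivity : 0 ≤ ‖A (y + k * π / n + u)‖ + ‖A (y + k * π / n - u)‖)]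
        exact mul_le_mul_of_nonneg_right (abs_norm_sub_norm_le _ _) (by positivity)
    _ ≤ _ := by
        rw [Finset.sum_add_distrib]
        have := hCS u
        have := hCS (-u)
        linarith

/-- convex null sequence vanishing from `m` on -/
structure CSeq (c : ℕ → ℝ) (m : ℕ) : Prop where
  zero : ∀ j, m ≤ j → c j = 0
  nn : ∀ j, 0 ≤ c j
  conv : ∀ j, 0 ≤ c j - 2 * c (j + 1) + c (j + 2)

lemma GG_nonneg (c : ℕ → ℝ) (m : ℕ) (hm : 0 < m) (hc : CSeq c m) (t : ℝ) : 0 ≤ GG c m t := by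
  rw [GG_eq c m hm hc.zero]
  exact Finset.sum_nonneg fun j _ => mul_nonneg (hc.conv j) (DD_nonneg _ _)

lemma GG_var (n : ℕ) (hn : 0 < n) (c : ℕ → ℝ) (m : ℕ) (hm : 2 ≤ m) (hmn : m ≤ 2 * n) (hc : CSeq c m)
    (y u : ℝ) (hu : 0 ≤ u) (hu' : u ≤ π / (2 * n)) :
    ∑ k ∈ Finset.range (2 * n), |GG c m (y + k * π / n + u) - GG c m (y + k * π / n - u)| ≤
      16 * π * ∑ j ∈ Finset.Ico 1 m, c j := by
  have hn' : (0 : ℝ) < n := by exact_mod_cast hn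
  set d : ℕ → ℝ := fun j => c j - 2 * c (j + 1) + c (j + 2) with hd
  have hG : ∀ t, GG c m t = ∑ j ∈ Finset.Ico 1 m, d j * DD (j + 1) t + d 0 := by
    intro t
    rw [GG_eq c m (by omega) hc.zero, Finset.range_eq_Ico, Finset.sum_eq_sum_Ico_succ_bot (by omega)]
    simp only [zero_add, DD_one, hd]
    ring
  have h0 : GG c m 0 = c 0 + 2 * ∑ j ∈ Finset.Ico 1 m, c j := by
    rw [GG, Finset.range_eq_Ico, Finset.sum_eq_sum_Ico_succ_bot (by omega), Finset.mul_sum]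
    congr 1
    · simp [ww]
    · refine Finset.sum_congr (by simp) fun j hj => ?_
      have := Finset.mem_Ico.1 hj
      simp [ww, show j ≠ 0 by omega, mul_comm]
  have h1 : ∑ j ∈ Finset.Ico 1 m, d j * ((j + 1 : ℕ) : ℝ) ^ 2 ≤ 4 * ∑ j ∈ Finset.Ico 1 m, c j := by
    have h2 := hG 0
    simp_rw [DD_at_zero] at h2
    have h3 : c 1 ≤ ∑ j ∈ Finset.Ico 1 m, c j :=
      Finset.single_le_sum (fun j _ => hc.nn j) (Finset.mem_Ico.2 ⟨le_rfl, by omega⟩)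
    have h4 : d 0 = c 0 - 2 * c 1 + c 2 := rfl
    have := hc.nn 2
    linarith
  have hu8 : 8 * n * u ≤ 4 * π := by
    rw [le_div_iff₀ (by positivity)] at hu'
    linarith
  calc _ ≤ ∑ k ∈ Finset.range (2 * n), ∑ j ∈ Finset.Ico 1 m,
        d j * |DD (j + 1) (y + k * π / n + u) - DD (j + 1) (y + k * π / n - u)| := by
        refine Finset.sum_le_sum fun k _ => ?_
        rw [hG, hG, add_sub_add_right_eq_sub, ← Finset.sum_sub_distrib]
        refine (Finset.abs_sum_le_sum_abs _ _).trans (Finset.sum_le_sum fun j _ => ?_)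
        rw [← mul_sub, abs_mul, abs_of_nonneg (hc.conv j)]
    _ = ∑ j ∈ Finset.Ico 1 m, d j * ∑ k ∈ Finset.range (2 * n),
         |DD (j + 1) (y + k * π / n + u) - DD (j + 1) (y + k * π / n - u)| := by
        rw [Finset.sum_comm]
        simp_rw [Finset.mul_sum]
    _ ≤ ∑ j ∈ Finset.Ico 1 m, 4 * π * (d j * ((j + 1 : ℕ) : ℝ) ^ 2) := by
        refine Finset.sum_le_sum fun j hj => ?_
        have := Finset.mem_Ico.1 hj
        have h5 := DD_var n hn (j + 1) (by omega) y u hu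
        refine (mul_le_mul_of_nonneg_left h5 (hc.conv j)).trans ?_
        have h6 := mul_le_mul_of_nonneg_left hu8 (mul_nonneg (hc.conv j) (sq_nonneg ((j + 1 : ℕ) : ℝ)))
        simp only [hd]
        linarith
    _ ≤ _ := by
        rw [← Finset.mul_sum]
        have := mul_le_mul_of_nonneg_left h1 (by positivity : 0 ≤ 4 * π)
        linarith

lemma GG_mean (n : ℕ) (hn : 0 < n) (c : ℕ → ℝ) (m : ℕ) (hm : 0 < m) (hmn : m ≤ 2 * n) (y : ℝ) :
    ∑ k ∈ Finset.range (2 * n), GG c m (y + k * π / n) = 2 * n * c 0 := by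
  unfold GG
  rw [Finset.sum_comm, Finset.range_eq_Ico, Finset.sum_eq_sum_Ico_succ_bot (by omega)]
  rw [Finset.sum_eq_zero (s := Finset.Ico (0 + 1) m)]
  · simp [ww]
  · intro j hj
    have hj' := Finset.mem_Ico.1 hj
    have := alias_cos n hn (j : ℤ) ?_ y 0
    · simp only [ww, show j ≠ 0 by omega, if_false]
      rw [← Finset.mul_sum, ← Finset.mul_sum]
      simp only [sub_zero, Int.cast_natCast] at this
      rw [this]; simp
    · intro hd
      have := Int.le_of_dvd (by omega) hd
      omega

lemma GG_TP (c : ℕ → ℝ) (m d : ℕ) (hd : m ≤ d + 1) : (fun t : ℝ => ((GG c m t : ℝ) : ℂ)) ∈ TP d := by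
  have : (fun t : ℝ => ((GG c m t : ℝ) : ℂ)) = ∑ j ∈ Finset.range m,
      (c j * (if j = 0 then 1 else 2) : ℂ) • (fun x : ℝ => ((Real.cos (j * x) : ℝ) : ℂ)) := by
    funext t
    rw [Finset.sum_apply, GG, Complex.ofReal_sum]
    refine Finset.sum_congr rfl fun j _ => ?_
    simp only [Pi.smul_apply, smul_eq_mul, ww]
    split_ifs with h
    · simp [h]
    · push_cast; ring
  rw [this]
  refine Submodule.sum_mem _ fun j hj => Submodule.smul_mem _ _ (TP_cos _ _ ?_)
  have := Finset.mem_range.1 hj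
  omega

lemma main_disc (ω h : ℝ → ℝ) (hω : IsModulus ω) (hh : HasMod ω h) (hp : Function.Periodic h (2 * π))
    (n N m : ℕ) (hm : 2 ≤ m) (hN : 0 < N) (hNm : N + m ≤ n) (hnN : n ≤ 4 * N)
    (c : ℕ → ℝ) (hc : CSeq c m) (y u : ℝ) (hu : 0 ≤ u) (hu' : u ≤ π / (2 * n)) :
    |∑ k ∈ Finset.range (2 * n), (-1 : ℝ) ^ k * (h (y + k * π / n + u) * GG c m (y + k * π / n + u)
      - h (y + k * π / n - u) * GG c m (y + k * π / n - u))| ≤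
    2 * n * c 0 * ω (2 * u) + 1500 * ω (1 / n) * (16 * π * ∑ j ∈ Finset.Ico 1 m, c j) := by
  obtain ⟨p, hpT, hpb⟩ := jackson ω h hω hh hp n N hN (by omega) hnN
  have hzero : ∑ k ∈ Finset.range (2 * n), (-1 : ℂ) ^ k * (p (y + k * π / n - u) *
      ((GG c m (y + k * π / n + u) : ℂ) - (GG c m (y + k * π / n - u) : ℂ))) = 0 := by
    have hG := GG_TP c m (m - 1) (by omega)
    have hq := TP_mul N (m - 1) _ _ (TP_shift _ _ hpT (-u))
      (Submodule.sub_mem _ (TP_shift _ _ hG u) (TP_shift _ _ hG (-u)))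
    have := TP_alt n (N + (m - 1)) (by omega) _ hq y
    simpa [sub_eq_add_neg] using this
  have hsplit : ((∑ k ∈ Finset.range (2 * n), (-1 : ℝ) ^ k * (h (y + k * π / n + u) * GG c m (y + k * π / n + u)
      - h (y + k * π / n - u) * GG c m (y + k * π / n - u)) : ℝ) : ℂ) =
      ∑ k ∈ Finset.range (2 * n), ((-1 : ℂ) ^ k * ((h (y + k * π / n + u) - h (y + k * π / n - u) : ℝ) *
        (GG c m (y + k * π / n + u) : ℂ)) + (-1 : ℂ) ^ k * (((h (y + k * π / n - u) : ℂ) - p (y + k * π / n - u)) *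
      ((GG c m (y + k * π / n + u) : ℂ) - (GG c m (y + k * π / n - u) : ℂ)))) := by
    rw [← add_zero (∑ k ∈ Finset.range (2 * n), _ : ℂ), ← hzero, ← Finset.sum_add_distrib]
    push_cast
    refine Finset.sum_congr rfl fun k _ => ?_
    ring
  rw [← Real.norm_eq_abs, ← Complex.norm_real, hsplit]
  have h4 : 0 ≤ ω (1 / n) := hω.2.2.2.2 _ (by positivity)
  calc _ ≤ ∑ k ∈ Finset.range (2 * n), (ω (2 * u) * GG c m ((y + u) + k * π / n) +
        1500 * ω (1 / n) * |GG c m (y + k * π / n + u) - GG c m (y + k * π / n - u)|) := by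
        refine (norm_sum_le _ _).trans (Finset.sum_le_sum fun k _ => (norm_add_le _ _).trans ?_)
        apply add_le_add
        · rw [norm_mul, norm_mul, norm_pow, norm_neg, norm_one, one_pow, one_mul, Complex.norm_real,
            Complex.norm_real, Real.norm_eq_abs, Real.norm_eq_abs, abs_of_nonneg (GG_nonneg c m (by omega) hc _),
            show y + u + k * π / n = y + k * π / n + u by ring]
          refine mul_le_mul_of_nonneg_right ?_ (GG_nonneg c m (by omega) hc _)
          have := hh (2 * u) (by positivity) (y + k * π / n - u) (2 * u) (by rw [abs_of_nonneg (by positivity)])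
          rwa [show y + k * π / n - u + 2 * u = y + k * π / n + u by ring] at this
        · rw [norm_mul, norm_mul, norm_pow, norm_neg, norm_one, one_pow, one_mul, ← Complex.ofReal_sub, Complex.norm_real,
            Real.norm_eq_abs]
          exact mul_le_mul_of_nonneg_right (hpb _) (abs_nonneg _)
    _ ≤ _ := by
        rw [Finset.sum_add_distrib, ← Finset.mul_sum, ← Finset.mul_sum, GG_mean n (by omega) c m (by omega) (by omega)]
        have := GG_var n (by omega) c m hm (by omega) hc y u hu hu'
        have := mul_le_mul_of_nonneg_left this (by positivity : 0 ≤ 1500 * ω (1 / n))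
        linarith

lemma sin_shift (n : ℕ) (hn : 0 < n) (k : ℕ) (u : ℝ) :
    Real.sin (n * (u + k * π / n)) = (-1) ^ k * Real.sin (n * u) := by
  have hn' : (n : ℝ) ≠ 0 := by exact_mod_cast hn.ne'
  rw [show (n : ℝ) * (u + k * π / n) = n * u + k * π by field_simp]
  rw [Real.sin_add_nat_mul_pi]

lemma decomp (F : ℝ → ℝ) (hF : Continuous F) (hp : Function.Periodic F (2 * π)) (n : ℕ) (hn : 0 < n) :
    ∫ t in (-π)..π, F t * Real.sin (n * t) = ∫ u in (0 : ℝ)..(π / (2 * n)), Real.sin (n * u) *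
      ∑ k ∈ Finset.range (2 * n), (-1 : ℝ) ^ k * (F (k * π / n + u) - F (k * π / n - u)) := by
  have hn' : (n : ℝ) ≠ 0 := by exact_mod_cast hn.ne'
  set Q : ℝ → ℝ := fun t => F t * Real.sin (n * t) with hQ
  have hQc : Continuous Q := by rw [hQ]; fun_prop
  have hQp : Function.Periodic Q (2 * π) := by
    intro t
    simp only [hQ]
    rw [hp t, show (n : ℝ) * (t + 2 * π) = n * t + n * (2 * π) by ring, Real.sin_add_nat_mul_two_pi]
  set b : ℝ := π / (2 * n) with hb
  have e1 : ∫ t in (-π)..π, Q t = ∫ t in (-b)..(-b + 2 * π), Q t := by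
    have := hQp.intervalIntegral_add_eq (-π) (-b)
    rw [← this]; congr 1; ring
  have e2 : ∫ t in (-b)..(-b + 2 * π), Q t = ∑ k ∈ Finset.range (2 * n),
      ∫ t in (-b + k * π / n)..(-b + (k + 1 : ℕ) * π / n), Q t := by
    have := intervalIntegral.sum_integral_adjacent_intervals (f := Q) (μ := volume)
      (a := fun k : ℕ => -b + k * π / n) (n := 2 * n) (fun k _ => hQc.intervalIntegrable _ _)
    rw [this]
    congr 1
    · simp
    · push_cast; field_simp
  have e3 : ∀ k : ℕ, ∫ t in (-b + k * π / n)..(-b + (k + 1 : ℕ) * π / n), Q t =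
      ∫ u in (0 : ℝ)..b, Real.sin (n * u) * ((-1 : ℝ) ^ k * (F (k * π / n + u) - F (k * π / n - u))) := by
    intro k
    have h1 : ∫ t in (-b + k * π / n)..(-b + (k + 1 : ℕ) * π / n), Q t =
        ∫ u in (-b)..b, Q (u + k * π / n) := by
      rw [intervalIntegral.integral_comp_add_right]
      congr 1
      rw [hb]; push_cast; field_simp; ring
    have hc : Continuous fun u => Q (u + k * π / n) := by fun_prop
    rw [h1, ← intervalIntegral.integral_add_adjacent_intervals (b := 0)
      (hc.intervalIntegrable _ _) (hc.intervalIntegrable _ _)]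
    have h2 : ∫ u in (-b)..0, Q (u + k * π / n) = ∫ u in (0 : ℝ)..b, Q (-u + k * π / n) := by
      have := intervalIntegral.integral_comp_neg (a := 0) (b := b) (fun u => Q (u + k * π / n))
      rw [this]; simp
    rw [h2, ← intervalIntegral.integral_add]
    · refine intervalIntegral.integral_congr fun u _ => ?_
      simp only [hQ]
      rw [sin_shift n hn, sin_shift n hn, mul_neg, Real.sin_neg, add_comm u, neg_add_eq_sub]
      ring
    · exact Continuous.intervalIntegrable (by fun_prop) _ _
    · exact Continuous.intervalIntegrable (by fun_prop) _ _
  rw [e1, e2]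
  simp_rw [e3, Finset.mul_sum]
  rw [intervalIntegral.integral_finsetSum]
  intro k _
  exact Continuous.intervalIntegrable (by fun_prop) _ _

lemma phase (F : ℝ → ℝ) (hp : Function.Periodic F (2 * π)) (n : ℕ) (hn : 0 < n) (θ : ℝ) :
    ∫ t in (-π)..π, F t * Real.cos (n * t - θ) =
    ∫ t in (-π)..π, F (t + (θ - π / 2) / n) * Real.sin (n * t) := by
  have hn' : (n : ℝ) ≠ 0 := by exact_mod_cast hn.ne'
  set Q : ℝ → ℝ := fun t => F t * Real.cos (n * t - θ) with hQ
  have hQp : Function.Periodic Q (2 * π) := by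
    intro t
    simp only [hQ]
    rw [hp t, show (n : ℝ) * (t + 2 * π) - θ = n * t - θ + n * (2 * π) by ring, Real.cos_add_nat_mul_two_pi]
  have e1 : ∀ t, F (t + (θ - π / 2) / n) * Real.sin (n * t) = Q (t + (θ - π / 2) / n) := by
    intro t
    simp only [hQ]
    rw [show (n : ℝ) * (t + (θ - π / 2) / n) - θ = n * t - π / 2 by field_simp; ring, Real.cos_sub_pi_div_two]
  simp_rw [e1]
  rw [intervalIntegral.integral_comp_add_right]
  have := hQp.intervalIntegral_add_eq (-π) (-π + (θ - π / 2) / n)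
  rw [show -π + 2 * π = π by ring] at this
  rw [this]
  congr 1
  ring

lemma eN_eq (ω : ℝ → ℝ) (n : ℕ) (hn : 0 < n) :
    ∫ u in (0 : ℝ)..(π / (2 * n)), Real.sin (n * u) * ω (2 * u) = eN n ω / n := by
  have hn' : (n : ℝ) ≠ 0 := by exact_mod_cast hn.ne'
  have := intervalIntegral.integral_comp_mul_left (a := 0) (b := π / (2 * n))
    (fun t => ω (2 * t / n) * Real.sin t) hn'
  rw [mul_zero, show (n : ℝ) * (π / (2 * n)) = π / 2 by field_simp] at this
  rw [smul_eq_mul] at this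
  rw [show eN n ω / n = (n : ℝ)⁻¹ * eN n ω by ring, eN, ← this]
  refine intervalIntegral.integral_congr fun u _ => ?_
  rw [mul_comm, show 2 * (n * u) / n = 2 * u by field_simp]

lemma sin_int (n : ℕ) (hn : 0 < n) : ∫ u in (0 : ℝ)..(π / (2 * n)), Real.sin (n * u) = 1 / n := by
  have hn' : (n : ℝ) ≠ 0 := by exact_mod_cast hn.ne'
  rw [intervalIntegral.integral_comp_mul_left _ hn']
  rw [mul_zero, show (n : ℝ) * (π / (2 * n)) = π / 2 by field_simp, integral_sin]
  simp

lemma om_cont (ω : ℝ → ℝ) (hω : IsModulus ω) (b : ℝ) (hb : 0 ≤ b) (n : ℕ) :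
    IntervalIntegrable (fun u => Real.sin (n * u) * ω (2 * u)) volume 0 b := by
  apply ContinuousOn.intervalIntegrable
  rw [Set.uIcc_of_le hb]
  refine ContinuousOn.mul (by fun_prop) ?_
  refine hω.1.comp (by fun_prop) ?_
  intro u hu
  exact Set.mem_Ici.2 (by linarith [hu.1])

lemma GG_cont (c : ℕ → ℝ) (m : ℕ) : Continuous (GG c m) := by
  unfold GG
  refine continuous_finsetSum _ fun j _ => ?_
  unfold ww
  split_ifs <;> fun_prop

lemma GG_per (c : ℕ → ℝ) (m : ℕ) : Function.Periodic (GG c m) (2 * π) := by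
  intro t
  unfold GG
  refine Finset.sum_congr rfl fun j _ => ?_
  unfold ww
  rw [show (j : ℝ) * (t + 2 * π) = j * t + j * (2 * π) by ring, Real.cos_add_nat_mul_two_pi]

lemma main_int (ω φ : ℝ → ℝ) (hω : IsModulus ω) (hh : HasMod ω φ) (hp : Function.Periodic φ (2 * π))
    (hφ : Continuous φ)
    (n N m : ℕ) (hm : 2 ≤ m) (hN : 0 < N) (hNm : N + m ≤ n) (hnN : n ≤ 4 * N)
    (c : ℕ → ℝ) (hc : CSeq c m) (θ x : ℝ) :
    |∫ t in (-π)..π, φ (x - t) * GG c m t * Real.cos (n * t - θ)| ≤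
      2 * c 0 * eN n ω + 1500 * ω (1 / n) * (16 * π * ∑ j ∈ Finset.Ico 1 m, c j) / n := by
  have hn : 0 < n := by omega
  have hn' : (0 : ℝ) < n := by exact_mod_cast hn
  have hb : 0 ≤ π / (2 * n) := by positivity
  set h : ℝ → ℝ := fun t => φ (x - t) with hhd
  have hhM : HasMod ω h := by
    intro t ht s v hv
    have := hh t ht (x - s) (-v) (by rwa [abs_neg])
    simp only [hhd]
    rwa [show x - (s + v) = x - s + -v by ring]
  have hhp : Function.Periodic h (2 * π) := by
    intro s
    simp only [hhd]
    rw [show x - (s + 2 * π) = x - s - 2 * π by ring, hp.sub_eq]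
  have hGc := GG_cont c m
  have hhc : Continuous h := by rw [hhd]; fun_prop
  have hFp : Function.Periodic (fun t => h t * GG c m t) (2 * π) := hhp.mul (GG_per c m)
  set y : ℝ := (θ - π / 2) / n with hy
  have e1 := phase (fun t => h t * GG c m t) hFp n hn θ
  rw [← hy] at e1
  have hFp2 : Function.Periodic (fun t => h (t + y) * GG c m (t + y)) (2 * π) := by
    intro t
    have := hFp (t + y)
    simp only at this ⊢
    rw [show t + 2 * π + y = t + y + 2 * π by ring, this]
  have e2 := decomp (fun t => h (t + y) * GG c m (t + y)) (by fun_prop) hFp2 n hn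
  rw [e1, e2]
  set B : ℝ := 1500 * ω (1 / n) * (16 * π * ∑ j ∈ Finset.Ico 1 m, c j) with hB
  have hint := om_cont ω hω _ hb n
  have e3 : ∫ u in (0 : ℝ)..(π / (2 * n)), (2 * n * c 0 * (Real.sin (n * u) * ω (2 * u)) + B * Real.sin (n * u)) =
      2 * c 0 * eN n ω + B / n := by
    rw [intervalIntegral.integral_add (hint.const_mul _) (Continuous.intervalIntegrable (by fun_prop) _ _),
      intervalIntegral.integral_const_mul, intervalIntegral.integral_const_mul, eN_eq ω n hn, sin_int n hn]
    field_simp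
  rw [← e3, ← Real.norm_eq_abs]
  apply intervalIntegral.norm_integral_le_of_norm_le hb
  · refine Filter.Eventually.of_forall fun u hu => ?_
    have hsin : 0 ≤ Real.sin (n * u) := by
      apply Real.sin_nonneg_of_nonneg_of_le_pi
      · have := hu.1.le; positivity
      · have := hu.2
        rw [le_div_iff₀ (by positivity)] at this
        nlinarith [Real.pi_pos]
    have := main_disc ω h hω hhM hhp n N m hm hN hNm hnN c hc y u hu.1.le hu.2
    rw [Real.norm_eq_abs, abs_mul, abs_of_nonneg hsin]
    have e4 : ∀ k : ℕ, k * π / n + u + y = y + k * π / n + u := fun k => by ring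
    have e5 : ∀ k : ℕ, k * π / n - u + y = y + k * π / n - u := fun k => by ring
    simp_rw [e4, e5]
    refine (mul_le_mul_of_nonneg_left this hsin).trans (le_of_eq ?_)
    rw [hB]; ring
  · exact (hint.const_mul _).add (Continuous.intervalIntegrable (by fun_prop) _ _)

lemma phi_bound (ω φ : ℝ → ℝ) (hω : IsModulus ω) (hh : HasMod ω φ) (hp : Function.Periodic φ (2 * π))
    (hφ : Continuous φ) (h0 : ∫ t in (-π)..π, φ t = 0) (n : ℕ) (hn : 0 < n) (x : ℝ) :
    |φ x| ≤ 5 * n * ω (1 / n) := by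
  have hn' : (1 : ℝ) ≤ n := by exact_mod_cast hn
  have hpi := Real.pi_pos
  have h1 : ∫ t in (-π)..π, φ (x + t) = 0 := by
    rw [intervalIntegral.integral_comp_add_left]
    have := hp.intervalIntegral_add_eq (-π) (x + -π)
    rw [show -π + 2 * π = π by ring, h0] at this
    rw [this]; congr 1; ring
  have h2 : ∫ t in (-π)..π, (φ (x + t) - φ x) = - (2 * π * φ x) := by
    rw [intervalIntegral.integral_sub (Continuous.intervalIntegrable (by fun_prop) _ _)
      (Continuous.intervalIntegrable (by fun_prop) _ _), h1]
    rw [intervalIntegral.integral_const, smul_eq_mul]; ring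
  have h3 : ‖∫ t in (-π)..π, (φ (x + t) - φ x)‖ ≤ ω π * |π - (-π)| := by
    apply intervalIntegral.norm_integral_le_of_norm_le_const
    intro t ht
    rw [Set.uIoc_of_le (by linarith)] at ht
    exact hh π hpi.le x t (abs_le.2 ⟨ht.1.le, ht.2⟩)
  rw [h2, norm_neg, Real.norm_eq_abs, abs_mul, abs_of_pos (by positivity : 0 < 2 * π),
    abs_of_pos (by linarith : 0 < π - -π)] at h3
  have h4 : |φ x| ≤ ω π := by
    have : 2 * π * |φ x| ≤ 2 * π * ω π := by linarith
    exact le_of_mul_le_mul_left this (by positivity)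
  have h5 := mod_le ω hω n hn π hpi.le
  have h6 : 0 ≤ ω (1 / n) := hω.2.2.2.2 _ (by positivity)
  have h7 : 1 + n * π ≤ 5 * n := by nlinarith [Real.pi_lt_d2]
  exact h4.trans (h5.trans (mul_le_mul_of_nonneg_right h7 h6))

/-- the natural-number facts about `ψ` used below -/
structure PsiOK (ψ : ℝ → ℝ) (n : ℕ) : Prop where
  summ : Summable fun k : ℕ => ψ (k + 1)
  nn : ∀ k : ℕ, 0 ≤ ψ k
  anti : ∀ k : ℕ, n ≤ k → ψ (k + 1) ≤ ψ k
  conv : ∀ k : ℕ, n ≤ k → 0 ≤ ψ k - 2 * ψ (k + 1) + ψ (k + 2)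

lemma PsiOK.nn1 {ψ : ℝ → ℝ} {n : ℕ} (h : PsiOK ψ n) (k : ℕ) : 0 ≤ ψ (k + 1) := by
  have := h.nn (k + 1); push_cast at this; exact this

lemma psi_term {ψ : ℝ → ℝ} {n : ℕ} (h : PsiOK ψ n) (θ t : ℝ) (k : ℕ) :
    ‖ψ (k + 1) * Real.cos ((k + 1) * t - θ)‖ ≤ ψ (k + 1) := by
  rw [norm_mul, Real.norm_eq_abs, abs_of_nonneg (h.nn1 k)]
  exact mul_le_of_le_one_right (h.nn1 k) (Real.abs_cos_le_one _)

lemma PsiKer_cont {ψ : ℝ → ℝ} {n : ℕ} (h : PsiOK ψ n) (β : ℝ) : Continuous (PsiKer ψ β) := by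
  unfold PsiKer
  exact continuous_tsum (fun k => by fun_prop) h.summ (fun k t => psi_term h _ t k)

lemma PsiKer_tail {ψ : ℝ → ℝ} {n : ℕ} (h : PsiOK ψ n) (β t : ℝ) (M : ℕ) :
    |PsiKer ψ β t - ∑ k ∈ Finset.range M, ψ (k + 1) * Real.cos ((k + 1) * t - β * π / 2)| ≤
      ∑' k : ℕ, ψ ((k + M : ℕ) + 1) := by
  have hs : Summable fun k : ℕ => ψ (k + 1) * Real.cos ((k + 1) * t - β * π / 2) :=
    Summable.of_norm_bounded h.summ (fun k => psi_term h _ t k)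
  have h1 := hs.sum_add_tsum_nat_add M
  unfold PsiKer
  rw [← h1, add_sub_cancel_left, ← Real.norm_eq_abs]
  have h2 : Summable fun k : ℕ => ψ ((k + M : ℕ) + 1) := (summable_nat_add_iff M).2 h.summ
  exact tsum_of_norm_bounded h2.hasSum (fun k => psi_term h _ t (k + M))

lemma GG_ext (c : ℕ → ℝ) (m M : ℕ) (hmM : m ≤ M) (f : ℕ → ℝ) (hc : ∀ j, m ≤ j → c j = 0) :
    ∑ j ∈ Finset.range m, c j * f j = ∑ j ∈ Finset.range M, c j * f j := by
  apply Finset.sum_subset (Finset.range_subset_range.2 hmM)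
  intro j _ hj
  rw [hc j (by simpa using hj), zero_mul]

lemma kid (ψ : ℝ → ℝ) (c : ℕ → ℝ) (m n : ℕ) (hn : 0 < n) (hmn : m ≤ n) (hc : ∀ j, m ≤ j → c j = 0) (t θ : ℝ) :
    ∑ k ∈ Finset.range n, ((if k = 0 then 0 else ψ k) - c (n - k)) * Real.cos (k * t - θ)
      + GG c m t * Real.cos (n * t - θ) =
    ∑ k ∈ Finset.range (n - 1), ψ (k + 1) * Real.cos ((k + 1) * t - θ) +
      ∑ j ∈ Finset.range m, c j * Real.cos ((n + j : ℝ) * t - θ) := by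
  have h1 : ∑ k ∈ Finset.range n, c (n - k) * Real.cos (k * t - θ) =
      ∑ j ∈ Finset.range n, c (j + 1) * Real.cos ((n - (j + 1) : ℝ) * t - θ) := by
    rw [← Finset.sum_range_reflect]
    refine Finset.sum_congr rfl fun j hj => ?_
    have hj' := Finset.mem_range.1 hj
    have : ((n - 1 - j : ℕ) : ℝ) = n - (j + 1) := by
      rw [Nat.cast_sub (by omega), Nat.cast_sub (by omega)]; push_cast; ring
    rw [this, show n - (n - 1 - j) = j + 1 by omega]
  have h2 : ∑ k ∈ Finset.range n, (if k = 0 then 0 else ψ k) * Real.cos (k * t - θ) =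
      ∑ k ∈ Finset.range (n - 1), ψ (k + 1) * Real.cos ((k + 1) * t - θ) := by
    obtain ⟨n', rfl⟩ : ∃ n', n = n' + 1 := ⟨n - 1, by omega⟩
    rw [Finset.sum_range_succ']
    simp
  have h3 : GG c m t * Real.cos (n * t - θ) = c 0 * Real.cos (n * t - θ) + ∑ j ∈ Finset.range n,
      c (j + 1) * (2 * Real.cos ((j + 1) * t) * Real.cos (n * t - θ)) := by
    rw [GG, GG_ext c m (n + 1) (by omega) _ hc, Finset.sum_range_succ', add_mul, Finset.sum_mul, add_comm]
    congr 1
    · simp [ww]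
    · refine Finset.sum_congr rfl fun j _ => ?_
      simp [ww]; ring
  have h4 : ∑ j ∈ Finset.range m, c j * Real.cos ((n + j : ℝ) * t - θ) = c 0 * Real.cos (n * t - θ) +
      ∑ j ∈ Finset.range n, c (j + 1) * Real.cos ((n + (j + 1) : ℝ) * t - θ) := by
    rw [GG_ext c m (n + 1) (by omega) _ hc, Finset.sum_range_succ', add_comm]
    simp
  simp_rw [sub_mul]
  rw [Finset.sum_sub_distrib, h1, h2, h3, h4]
  have h5 : ∑ j ∈ Finset.range n, c (j + 1) * (2 * Real.cos ((j + 1) * t) * Real.cos (n * t - θ)) =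
     ∑ j ∈ Finset.range n, c (j + 1) * Real.cos ((n - (j + 1) : ℝ) * t - θ) +
     ∑ j ∈ Finset.range n, c (j + 1) * Real.cos ((n + (j + 1) : ℝ) * t - θ) := by
    rw [← Finset.sum_add_distrib]
    refine Finset.sum_congr rfl fun j _ => ?_
    rw [← mul_add]
    congr 1
    rw [show (n - (j + 1) : ℝ) * t - θ = (n * t - θ) - (j + 1) * t by ring,
      show (n + (j + 1) : ℝ) * t - θ = (n * t - θ) + (j + 1) * t by ring]
    generalize (n * t - θ : ℝ) = A
    rw [Real.cos_sub, Real.cos_add]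
    ring
  rw [h5]; ring

/-- truncated coefficients -/
def cc (ψ : ℝ → ℝ) (n m : ℕ) (j : ℕ) : ℝ := if j < m then ψ (n + j : ℕ) - ψ (n + m : ℕ) else 0

lemma psi_anti {ψ : ℝ → ℝ} {n : ℕ} (h : PsiOK ψ n) (a b : ℕ) (ha : n ≤ a) (hab : a ≤ b) : ψ b ≤ ψ a := by
  induction b, hab using Nat.le_induction with
  | base => exact le_rfl
  | succ b hb ih =>
    push_cast
    exact (h.anti b (by omega)).trans ih

lemma cc_ok {ψ : ℝ → ℝ} {n : ℕ} (h : PsiOK ψ n) (m : ℕ) : CSeq (cc ψ n m) m := by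
  have hnn : ∀ j, 0 ≤ cc ψ n m j := by
    intro j
    unfold cc
    split_ifs with hj
    · linarith [psi_anti h (n + j) (n + m) (by omega) (by omega)]
    · exact le_rfl
  refine ⟨fun j hj => by simp [cc, not_lt.2 hj], hnn, fun j => ?_⟩
  have hle : ∀ j, j ≤ m → cc ψ n m j = ψ (n + j : ℕ) - ψ (n + m : ℕ) := by
    intro j hj
    unfold cc
    split_ifs with h1
    · rfl
    · have : j = m := by omega
      simp [this]
  by_cases hj : j + 2 ≤ m
  · rw [hle j (by omega), hle (j + 1) (by omega), hle (j + 2) hj]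
    have := h.conv (n + j) (by omega)
    push_cast at this ⊢
    rw [show (n : ℝ) + (j + 1) = n + j + 1 by ring, show (n : ℝ) + (j + 2) = n + j + 2 by ring]
    linarith
  · have h1 : cc ψ n m (j + 1) = 0 := by simp [cc]; omega
    rw [h1]
    linarith [hnn j, hnn (j + 2)]

lemma conv_cos (φ : ℝ → ℝ) (hφ : Continuous φ) (hp : Function.Periodic φ (2 * π)) (k : ℕ) (θ x : ℝ) :
    ∫ t in (-π)..π, φ (x - t) * Real.cos (k * t - θ) =
    (∫ s in (-π)..π, φ s * Real.cos (k * s + θ)) * Real.cos (k * x) +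
    (∫ s in (-π)..π, φ s * Real.sin (k * s + θ)) * Real.sin (k * x) := by
  set Q : ℝ → ℝ := fun s => φ s * Real.cos (k * (x - s) - θ) with hQ
  have hQp : Function.Periodic Q (2 * π) := by
    intro t
    simp only [hQ]
    rw [hp t, show (k : ℝ) * (x - (t + 2 * π)) - θ = k * (x - t) - θ - k * (2 * π) by ring,
      Real.cos_sub_nat_mul_two_pi]
  have e1 : ∫ t in (-π)..π, φ (x - t) * Real.cos (k * t - θ) = ∫ t in (-π)..π, Q (x - t) := by
    refine intervalIntegral.integral_congr fun t _ => ?_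
    simp only [hQ]
    rw [show x - (x - t) = t by ring]
  rw [e1, intervalIntegral.integral_comp_sub_left]
  have e2 := hQp.intervalIntegral_add_eq (-π) (x - π)
  rw [show -π + 2 * π = π by ring, show x - π + 2 * π = x - -π by ring] at e2
  rw [← e2, ← intervalIntegral.integral_mul_const, ← intervalIntegral.integral_mul_const,
    ← intervalIntegral.integral_add]
  · refine intervalIntegral.integral_congr fun t _ => ?_
    simp only [hQ]
    rw [show (k : ℝ) * (x - t) - θ = k * x - (k * t + θ) by ring, Real.cos_sub]
    ring
  · exact Continuous.intervalIntegrable (by fun_prop) _ _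
  · exact Continuous.intervalIntegrable (by fun_prop) _ _

lemma EnC_le (n : ℕ) (f T : ℝ → ℝ) (hT : IsTrigPoly n T) (B : ℝ) (hB : ∀ x, |f x - T x| ≤ B) :
    EnC n f ≤ B := by
  have hbb : BddBelow {e | ∃ T : ℝ → ℝ, IsTrigPoly n T ∧ e = ⨆ x : ℝ, |f x - T x|} := by
    refine ⟨0, ?_⟩
    rintro e ⟨S, _, rfl⟩
    exact Real.iSup_nonneg fun x => abs_nonneg _
  exact (csInf_le hbb ⟨T, hT, rfl⟩).trans (ciSup_le hB)

lemma upper (ψ : ℝ → ℝ) (n N m : ℕ) (hψ : PsiOK ψ n)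
    (hm : 2 ≤ m) (hN : 0 < N) (hNm : N + m ≤ n) (hnN : n ≤ 4 * N)
    (β : ℝ) (ω : ℝ → ℝ) (hω : IsModulus ω) (f : ℝ → ℝ) (hf : f ∈ CClass ψ β ω) :
    EnC n f ≤ (2 / π) * ψ n * eN n ω + 24000 * ω (1 / n) * (∑ j ∈ Finset.Ico 1 m, ψ (n + j : ℕ)) / n +
      10 * n * ω (1 / n) * (∑' k : ℕ, ψ ((k + (n - 1 + m) : ℕ) + 1) + m * ψ (n + m : ℕ)) := by
  obtain ⟨hfc, hfp, a₀, φ, hφ, hφp, hφ0, hφm, hfx⟩ := hf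
  have hφm' : HasMod ω φ := hφm
  have hn : 0 < n := by omega
  have hn' : (0 : ℝ) < n := by exact_mod_cast hn
  have hpi := Real.pi_pos
  set θ : ℝ := β * π / 2 with hθ
  set c := cc ψ n m with hcd
  have hc : CSeq c m := cc_ok hψ m
  set d : ℕ → ℝ := fun k => (if k = 0 then 0 else ψ k) - c (n - k) with hd
  set P : ℝ → ℝ := fun t => ∑ k ∈ Finset.range n, d k * Real.cos (k * t - θ) with hP
  have hω1 : 0 ≤ ω (1 / n) := hω.2.2.2.2 _ (by positivity)
  have heN : 0 ≤ eN n ω := by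
    unfold eN
    apply intervalIntegral.integral_nonneg (by positivity)
    intro u hu
    refine mul_nonneg (hω.2.2.2.2 _ (by have := hu.1; positivity)) ?_
    exact Real.sin_nonneg_of_nonneg_of_le_pi hu.1 (by linarith [hu.2])
  have hKc := PsiKer_cont hψ β
  have hGc := GG_cont c m
  have hPc : Continuous P := by rw [hP]; fun_prop
  set A : ℕ → ℝ := fun k => ∫ s in (-π)..π, φ s * Real.cos (k * s + θ) with hA
  set A' : ℕ → ℝ := fun k => ∫ s in (-π)..π, φ s * Real.sin (k * s + θ) with hA'
  set T : ℝ → ℝ := fun x => a₀ / 2 + (1 / π) * ∫ t in (-π)..π, φ (x - t) * P t with hT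
  have hTt : IsTrigPoly n T := by
    refine ⟨fun k => (if k = 0 then a₀ / 2 else 0) + (1 / π) * (d k * A k), fun k => (1 / π) * (d k * A' k), ?_⟩
    intro x
    have e1 : ∫ t in (-π)..π, φ (x - t) * P t = ∑ k ∈ Finset.range n,
        d k * (A k * Real.cos (k * x) + A' k * Real.sin (k * x)) := by
      have : ∀ t, φ (x - t) * P t = ∑ k ∈ Finset.range n, d k * (φ (x - t) * Real.cos (k * t - θ)) := by
        intro t
        simp only [hP]
        rw [Finset.mul_sum]
        refine Finset.sum_congr rfl fun k _ => by ring
      simp_rw [this]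
      rw [intervalIntegral.integral_finsetSum]
      · refine Finset.sum_congr rfl fun k _ => ?_
        rw [intervalIntegral.integral_const_mul, conv_cos φ hφ hφp k θ x]
      · intro k _
        exact Continuous.intervalIntegrable (by fun_prop) _ _
    simp only [hT]
    rw [e1, Finset.mul_sum]
    simp_rw [add_mul]
    rw [Finset.sum_add_distrib, Finset.sum_add_distrib, add_assoc, ← Finset.sum_add_distrib]
    congr 1
    · rw [Finset.sum_eq_single 0]
      · simp
      · intro k _ hk; simp [hk]
      · intro h; exact absurd (Finset.mem_range.2 hn) h
    · refine Finset.sum_congr rfl fun k _ => by ring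
  set R : ℝ → ℝ := fun t => PsiKer ψ β t - P t - GG c m t * Real.cos (n * t - θ) with hR
  have hRc : Continuous R := by rw [hR]; fun_prop
  set τ : ℝ := ∑' k : ℕ, ψ ((k + (n - 1 + m) : ℕ) + 1) + m * ψ (n + m : ℕ) with hτ
  have hRb : ∀ t, |R t| ≤ τ := by
    intro t
    have h1 := PsiKer_tail hψ β t (n - 1 + m)
    have h2 := kid ψ c m n hn (by omega) hc.zero t θ
    rw [Finset.sum_range_add] at h1
    have h3 : ∑ x ∈ Finset.range m, ψ ((n - 1 + x : ℕ) + 1) * Real.cos (((n - 1 + x : ℕ) + 1) * t - β * π / 2) =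
        ∑ j ∈ Finset.range m, c j * Real.cos ((n + j : ℝ) * t - θ) +
        ∑ j ∈ Finset.range m, ψ (n + m : ℕ) * Real.cos ((n + j : ℝ) * t - θ) := by
      rw [← Finset.sum_add_distrib]
      refine Finset.sum_congr rfl fun j hj => ?_
      have e : ((n - 1 + j : ℕ) : ℝ) + 1 = n + j := by
        have : n - 1 + j + 1 = n + j := by omega
        exact_mod_cast this
      rw [e, hcd, cc, if_pos (Finset.mem_range.1 hj), ← add_mul, sub_add_cancel]
      push_cast; rfl
    rw [h3] at h1
    have h4 : R t = (PsiKer ψ β t - (∑ k ∈ Finset.range (n - 1), ψ (k + 1) * Real.cos ((k + 1) * t - β * π / 2) +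
      (∑ j ∈ Finset.range m, c j * Real.cos ((n + j : ℝ) * t - θ) +
        ∑ j ∈ Finset.range m, ψ (n + m : ℕ) * Real.cos ((n + j : ℝ) * t - θ)))) +
        ∑ j ∈ Finset.range m, ψ (n + m : ℕ) * Real.cos ((n + j : ℝ) * t - θ) := by
      simp only [hR, hP, hd]
      linarith
    rw [h4]
    refine (abs_add_le _ _).trans (add_le_add h1 ?_)
    refine (Finset.abs_sum_le_sum_abs _ _).trans ?_
    refine (Finset.sum_le_card_nsmul _ _ (ψ (n + m : ℕ)) ?_).trans (le_of_eq (by simp))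
    intro j _
    rw [abs_mul, abs_of_nonneg (hψ.nn _)]
    exact mul_le_of_le_one_right (hψ.nn _) (Real.abs_cos_le_one _)
  apply EnC_le n f T hTt
  intro x
  have e1 : f x - T x = (1 / π) * ((∫ t in (-π)..π, φ (x - t) * GG c m t * Real.cos (n * t - θ)) +
      ∫ t in (-π)..π, φ (x - t) * R t) := by
    rw [← intervalIntegral.integral_add (Continuous.intervalIntegrable (by fun_prop) _ _)
      (Continuous.intervalIntegrable (by fun_prop) _ _)]
    rw [hfx x]
    simp only [hT]
    rw [add_sub_add_left_eq_sub, ← mul_sub, ← intervalIntegral.integral_sub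
      (Continuous.intervalIntegrable (by fun_prop) _ _) (Continuous.intervalIntegrable (by fun_prop) _ _)]
    congr 1
    refine intervalIntegral.integral_congr fun t _ => ?_
    simp only [hR]
    ring
  have e2 := main_int ω φ hω hφm' hφp hφ n N m hm hN hNm hnN c hc θ x
  have e3 : |∫ t in (-π)..π, φ (x - t) * R t| ≤ (5 * n * ω (1 / n) * τ) * (2 * π) := by
    have : ‖∫ t in (-π)..π, φ (x - t) * R t‖ ≤ (5 * n * ω (1 / n) * τ) * |π - -π| := by
      apply intervalIntegral.norm_integral_le_of_norm_le_const
      intro t _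
      rw [Real.norm_eq_abs, abs_mul]
      exact mul_le_mul (phi_bound ω φ hω hφm' hφp hφ hφ0 n hn _) (hRb t) (abs_nonneg _) (by positivity)
    rw [Real.norm_eq_abs] at this
    rwa [show π - -π = 2 * π by ring, abs_of_pos (by positivity : 0 < 2 * π)] at this
  have e4 : c 0 ≤ ψ n := by
    rw [hcd, cc, if_pos (by omega)]
    have := hψ.nn (n + m)
    simp only [add_zero]
    linarith
  have e5 : ∑ j ∈ Finset.Ico 1 m, c j ≤ ∑ j ∈ Finset.Ico 1 m, ψ (n + j : ℕ) := by
    refine Finset.sum_le_sum fun j hj => ?_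
    rw [hcd, cc, if_pos (Finset.mem_Ico.1 hj).2]
    have := hψ.nn (n + m)
    linarith
  rw [e1, abs_mul, abs_of_pos (by positivity : 0 < 1 / π)]
  calc _ ≤ 1 / π * ((2 * ψ n * eN n ω + 1500 * ω (1 / n) * (16 * π * ∑ j ∈ Finset.Ico 1 m, ψ (n + j : ℕ)) / n)
        + (5 * n * ω (1 / n) * τ) * (2 * π)) := by
        refine mul_le_mul_of_nonneg_left ((abs_add_le _ _).trans (add_le_add (e2.trans ?_) e3)) (by positivity)
        gcongr
    _ = _ := by field_simp; ring


lemma asin_lip (a b : ℝ) : |Real.arcsin (Real.sin a) - Real.arcsin (Real.sin b)| ≤ |a - b| := by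
  have ha := Real.sin_arcsin (Real.neg_one_le_sin a) (Real.sin_le_one a)
  have hb := Real.sin_arcsin (Real.neg_one_le_sin b) (Real.sin_le_one b)
  have a1 := Real.arcsin_le_pi_div_two (Real.sin a)
  have a2 := Real.neg_pi_div_two_le_arcsin (Real.sin a)
  have b1 := Real.arcsin_le_pi_div_two (Real.sin b)
  have b2 := Real.neg_pi_div_two_le_arcsin (Real.sin b)
  generalize Real.arcsin (Real.sin a) = A at *
  generalize Real.arcsin (Real.sin b) = B at *
  obtain ⟨k, hk⟩ := Real.sin_eq_sin_iff.1 ha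
  obtain ⟨l, hl⟩ := Real.sin_eq_sin_iff.1 hb
  have hpi := Real.pi_pos
  have key : ∀ j : ℤ, (j : ℝ) * π ≤ -π ∨ (j : ℝ) * π = 0 ∨ π ≤ j * π := by
    intro j
    rcases lt_trichotomy j 0 with h | h | h
    · left
      have : (j : ℝ) ≤ -1 := by exact_mod_cast (by omega : j ≤ -1)
      nlinarith
    · right; left; simp [h]
    · right; right
      have : (1 : ℝ) ≤ j := by exact_mod_cast (by omega : 1 ≤ j)
      nlinarith
  have k1 := key (k - l)
  have k2 := key (k + l)
  have k3 := key (k - l + 1)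
  have k4 := key (k - l - 1)
  push_cast at k1 k2 k3 k4
  ring_nf at k1 k2 k3 k4 hk hl
  generalize (k : ℝ) * π = X at *
  generalize (l : ℝ) * π = Y at *
  rcases hk with hk | hk <;> rcases hl with hl | hl <;> rw [hk, hl]
  · rcases abs_cases (A - B) with h | h <;> rcases k1 with k1 | k1 | k1 <;> apply le_abs.2 <;>
    first | (left; linarith) | (right; linarith)
  · rcases abs_cases (A - B) with h | h <;> rcases k1 with k1 | k1 | k1 <;> rcases k4 with k4 | k4 | k4 <;>
     apply le_abs.2 <;> first | (left; linarith) | (right; linarith)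
  · rcases abs_cases (A - B) with h | h <;> rcases k1 with k1 | k1 | k1 <;> rcases k3 with k3 | k3 | k3 <;>
     apply le_abs.2 <;> first | (left; linarith) | (right; linarith)
  · rcases abs_cases (A - B) with h | h <;> rcases k1 with k1 | k1 | k1 <;> apply le_abs.2 <;>
    first | (left; linarith) | (right; linarith)

def HH (ω : ℝ → ℝ) (v : ℝ) : ℝ := (ω (2 * max v 0) - ω (2 * max (-v) 0)) / 2

lemma HH_mono_aux (ω : ℝ → ℝ) (hω : IsModulus ω) (hc : ConcaveOn ℝ (Set.Ici 0) ω) (v w : ℝ) (h : v ≤ w) :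
    |HH ω w - HH ω v| ≤ ω (w - v) := by
  obtain ⟨-, hm, hs, h0, hn⟩ := hω
  have hdiff : ∀ a b, 0 ≤ a → a ≤ b → |(ω (2 * b) - ω (2 * a)) / 2| ≤ ω (b - a) := by
    intro a b ha hab
    have h1 : ω (2 * a) ≤ ω (2 * b) := hm (Set.mem_Ici.2 (by linarith)) (Set.mem_Ici.2 (by linarith)) (by linarith)
    have h2 := hs (2 * a) (2 * (b - a)) (by linarith) (by linarith)
    have h3 := hs (b - a) (b - a) (by linarith) (by linarith)
    rw [show 2 * a + 2 * (b - a) = 2 * b by ring] at h2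
    rw [show b - a + (b - a) = 2 * (b - a) by ring] at h3
    rw [abs_of_nonneg (by linarith)]
    linarith
  unfold HH
  rcases le_total 0 v with hv | hv
  · rw [max_eq_left hv, max_eq_left (hv.trans h), max_eq_right (by linarith : -v ≤ 0), max_eq_right (by linarith : -w ≤ 0)]
    have := hdiff v w hv h
    rw [mul_zero, h0]
    simpa [sub_div] using this
  · rcases le_total w 0 with hw | hw
    · rw [max_eq_right hv, max_eq_right hw, max_eq_left (by linarith : 0 ≤ -v), max_eq_left (by linarith : 0 ≤ -w)]
      have := hdiff (-w) (-v) (by linarith) (by linarith)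
      rw [mul_zero, h0]
      rw [show -v - -w = w - v by ring] at this
      refine le_trans (le_of_eq ?_) this
      congr 1; ring
    · rw [max_eq_right hv, max_eq_left hw, max_eq_left (by linarith : 0 ≤ -v), max_eq_right (by linarith : -w ≤ 0)]
      rw [mul_zero, h0]
      have := hc.2 (Set.mem_Ici.2 (by linarith : 0 ≤ 2 * w)) (Set.mem_Ici.2 (by linarith : 0 ≤ 2 * (-v)))
        (by norm_num : (0 : ℝ) ≤ 1 / 2) (by norm_num : (0 : ℝ) ≤ 1 / 2) (by norm_num)
      simp only [smul_eq_mul] at this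
      rw [show 1 / 2 * (2 * w) + 1 / 2 * (2 * -v) = w - v by ring] at this
      have g1 := hn (2 * w) (by linarith)
      have g2 := hn (2 * -v) (by linarith)
      rw [abs_of_nonneg (by linarith)]
      linarith

lemma HH_lip (ω : ℝ → ℝ) (hω : IsModulus ω) (hc : ConcaveOn ℝ (Set.Ici 0) ω) (v w : ℝ) :
    |HH ω w - HH ω v| ≤ ω |w - v| := by
  rcases le_total v w with h | h
  · rw [abs_of_nonneg (by linarith : 0 ≤ w - v)]; exact HH_mono_aux ω hω hc v w h
  · rw [abs_sub_comm, abs_sub_comm w, abs_of_nonneg (by linarith : 0 ≤ v - w)]; exact HH_mono_aux ω hω hc w v h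

lemma HH_neg (ω : ℝ → ℝ) (v : ℝ) : HH ω (-v) = - HH ω v := by
  unfold HH; rw [neg_neg]; ring

lemma HH_cont (ω : ℝ → ℝ) (hω : IsModulus ω) : Continuous (HH ω) := by
  have h1 : Continuous fun v : ℝ => ω (2 * max v 0) :=
    hω.1.comp_continuous (by fun_prop) (fun v => Set.mem_Ici.2 (by positivity))
  have h2 : Continuous fun v : ℝ => ω (2 * max (-v) 0) :=
    hω.1.comp_continuous (by fun_prop) (fun v => Set.mem_Ici.2 (by positivity))
  exact (h1.sub h2).div_const 2

def ph (ω : ℝ → ℝ) (n : ℕ) (t : ℝ) : ℝ := HH ω (Real.arcsin (Real.sin (n * t)) / n)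

lemma ph_cont (ω : ℝ → ℝ) (hω : IsModulus ω) (n : ℕ) : Continuous (ph ω n) := by
  unfold ph
  exact (HH_cont ω hω).comp ((Real.continuous_arcsin.comp (by fun_prop)).div_const _)

lemma ph_anti (ω : ℝ → ℝ) (n : ℕ) (hn : 0 < n) : Function.Antiperiodic (ph ω n) (π / n) := by
  intro x
  have hn' : (n : ℝ) ≠ 0 := by exact_mod_cast hn.ne'
  unfold ph
  rw [show (n : ℝ) * (x + π / n) = n * x + π by field_simp, Real.sin_add_pi, Real.arcsin_neg, neg_div, HH_neg]

lemma ph_neg (ω : ℝ → ℝ) (n : ℕ) (x : ℝ) : ph ω n (-x) = - ph ω n x := by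
  unfold ph
  rw [mul_neg, Real.sin_neg, Real.arcsin_neg, neg_div, HH_neg]

lemma ph_val (ω : ℝ → ℝ) (hω : IsModulus ω) (n : ℕ) (hn : 0 < n) (u : ℝ) (h0 : 0 ≤ u) (h1 : u ≤ π / (2 * n)) :
    ph ω n u = ω (2 * u) / 2 := by
  have hn' : (0 : ℝ) < n := by exact_mod_cast hn
  rw [le_div_iff₀ (by positivity)] at h1
  have : 0 ≤ n * u := by positivity
  unfold ph HH
  rw [Real.arcsin_sin (by linarith [Real.pi_pos]) (by linarith), mul_div_cancel_left₀ _ hn'.ne', max_eq_left h0,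
    max_eq_right (by linarith), mul_zero, hω.2.2.2.1, sub_zero]

lemma ph_mod (ω : ℝ → ℝ) (hω : IsModulus ω) (hc : ConcaveOn ℝ (Set.Ici 0) ω) (n : ℕ) (hn : 0 < n) :
    HasMod ω (ph ω n) := by
  intro t ht x v hv
  have hn' : (0 : ℝ) < n := by exact_mod_cast hn
  refine (HH_lip ω hω hc _ _).trans (hω.2.1 (Set.mem_Ici.2 (abs_nonneg _)) (Set.mem_Ici.2 ht) ?_)
  rw [← sub_div, abs_div, abs_of_pos hn', div_le_iff₀ hn']
  refine (asin_lip _ _).trans ?_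
  rw [show n * (x + v) - n * x = n * v by ring, abs_mul, abs_of_pos hn']
  nlinarith

lemma ph_bd (ω : ℝ → ℝ) (hω : IsModulus ω) (n : ℕ) (hn : 0 < n) (x : ℝ) : |ph ω n x| ≤ 3 * ω (1 / n) := by
  have hn' : (0 : ℝ) < n := by exact_mod_cast hn
  have hpi := Real.pi_pos
  have a1 := Real.arcsin_le_pi_div_two (Real.sin (n * x))
  have a2 := Real.neg_pi_div_two_le_arcsin (Real.sin (n * x))
  unfold ph HH
  set v := Real.arcsin (Real.sin (n * x)) / n with hv
  have v1 : v ≤ π / 2 / n := by rw [hv]; gcongr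
  have v2 : -v ≤ π / 2 / n := by rw [hv, ← neg_div]; gcongr; linarith
  have hb : ∀ z : ℝ, z ≤ π / 2 / n → 0 ≤ ω (2 * max z 0) ∧ ω (2 * max z 0) ≤ 6 * ω (1 / n) := by
    intro z hz
    have h0 : 0 ≤ 2 * max z 0 := by positivity
    refine ⟨hω.2.2.2.2 _ h0, (mod_le ω hω n hn _ h0).trans ?_⟩
    have h2 : max z 0 ≤ π / 2 / n := max_le hz (by positivity)
    rw [le_div_iff₀ hn'] at h2
    have := hω.2.2.2.2 (1 / n) (by positivity)
    have := Real.pi_lt_four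
    gcongr
    linarith
  have := hb v v1
  have := hb (-v) v2
  rw [abs_le]; constructor <;> linarith

lemma anti_per (φ : ℝ → ℝ) (n : ℕ) (hn : 0 < n) (h : Function.Antiperiodic φ (π / n)) : Function.Periodic φ (2 * π) := by
  intro x
  have hn' : (n : ℝ) ≠ 0 := by exact_mod_cast hn.ne'
  have := h.add_nat_mul_eq (x := x) (2 * n)
  rw [show ((2 * n : ℕ) : ℝ) * (π / n) = 2 * π by push_cast; field_simp] at this
  rw [this, pow_mul]; simp

lemma anti_mean (φ : ℝ → ℝ) (n : ℕ) (hn : 0 < n) (h : Function.Antiperiodic φ (π / n)) :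
    ∫ t in (-π)..π, φ t = 0 := by
  have hp := anti_per φ n hn h
  have h1 := intervalIntegral.integral_comp_add_right (a := -π) (b := π) φ (π / n)
  have h2 := hp.intervalIntegral_add_eq (-π) (-π + π / n)
  rw [show -π + 2 * π = π by ring, show -π + π / n + 2 * π = π + π / n by ring] at h2
  rw [← h2, show (fun x => φ (x + π / n)) = fun x => - φ x from funext h, intervalIntegral.integral_neg] at h1
  linarith

lemma anti_orth (φ : ℝ → ℝ) (hφ : Continuous φ) (n : ℕ) (hn : 0 < n) (h : Function.Antiperiodic φ (π / n))
    (l : ℕ) (h1 : 1 ≤ l) (h2 : l ≤ 2 * n) (h3 : l ≠ n) (x θ : ℝ) :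
    ∫ t in (-π)..π, φ (x - t) * Real.cos (l * t - θ) = 0 := by
  have hn' : (n : ℝ) ≠ 0 := by exact_mod_cast hn.ne'
  have hp := anti_per φ n hn h
  set Q : ℝ → ℝ := fun t => φ (x - t) * Real.cos (l * t - θ) with hQ
  have hQp : Function.Periodic Q (2 * π) := by
    intro t
    simp only [hQ]
    rw [show x - (t + 2 * π) = (x - t) - 2 * π by ring, hp.sub_eq,
      show (l : ℝ) * (t + 2 * π) - θ = l * t - θ + l * (2 * π) by ring, Real.cos_add_nat_mul_two_pi]
  have hj : ∀ j : ℕ, ∫ t in (-π)..π, Q t = ∫ t in (-π)..π, φ (x - t) * ((-1) ^ j * Real.cos ((l : ℤ) * (t + j * π / n) - θ)) := by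
    intro j
    have e1 := intervalIntegral.integral_comp_add_right (a := -π) (b := π) Q (j * π / n)
    have e2 := hQp.intervalIntegral_add_eq (-π) (-π + j * π / n)
    rw [show -π + 2 * π = π by ring, show -π + j * π / n + 2 * π = π + j * π / n by ring] at e2
    rw [e2, ← e1]
    refine intervalIntegral.integral_congr fun t _ => ?_
    simp only [hQ]
    rw [show x - (t + j * π / n) = (x - t) - j * (π / n) by ring, h.sub_nat_mul_eq]
    push_cast
    ring
  have hs : ∑ j ∈ Finset.range (2 * n), ∫ t in (-π)..π, Q t = 0 := by
    rw [Finset.sum_congr rfl fun j _ => hj j, ← intervalIntegral.integral_finsetSum]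
    · rw [← intervalIntegral.integral_zero (a := -π) (b := π) (μ := volume) (E := ℝ)]
      refine intervalIntegral.integral_congr fun t _ => ?_
      rw [← Finset.mul_sum, alias_alt_cos n hn (l : ℤ) ?_ t θ, mul_zero]
      rintro ⟨c, hc⟩
      have : (l : ℤ) ≠ n := by exact_mod_cast h3
      have c1 : 0 < c := by by_contra hh; push Not at hh; nlinarith
      have c2 : c < 2 := by by_contra hh; push Not at hh; nlinarith
      have : c = 1 := by omega
      subst this
      omega
    · intro j _
      exact Continuous.intervalIntegrable (by fun_prop) _ _
  rw [Finset.sum_const, Finset.card_range, nsmul_eq_mul] at hs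
  rcases mul_eq_zero.1 hs with h | h
  · exfalso
    have : (2 * n : ℕ) = 0 := by exact_mod_cast h
    omega
  · exact h

lemma ph_main (ω : ℝ → ℝ) (hω : IsModulus ω) (n : ℕ) (hn : 0 < n) (θ : ℝ) :
    ∫ t in (-π)..π, ph ω n ((θ + π / 2) / n - t) * Real.cos (n * t - θ) = 2 * eN n ω := by
  have hn' : (0 : ℝ) < n := by exact_mod_cast hn
  have hA := ph_anti ω n hn
  have hp := anti_per _ n hn hA
  set x := (θ + π / 2) / n with hx
  set Q : ℝ → ℝ := fun t => ph ω n t * Real.sin (n * t) with hQ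
  have hQp : Function.Periodic Q (2 * π) := by
    intro t
    simp only [hQ]
    rw [hp t, show (n : ℝ) * (t + 2 * π) = n * t + n * (2 * π) by ring, Real.sin_add_nat_mul_two_pi]
  have e1 : ∫ t in (-π)..π, ph ω n (x - t) * Real.cos (n * t - θ) = ∫ t in (-π)..π, Q (x - t) := by
    refine intervalIntegral.integral_congr fun t _ => ?_
    simp only [hQ]
    rw [show (n : ℝ) * (x - t) = π / 2 - (n * t - θ) by rw [hx]; field_simp; ring, Real.sin_pi_div_two_sub]
  rw [e1, intervalIntegral.integral_comp_sub_left]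
  have e2 := hQp.intervalIntegral_add_eq (-π) (x - π)
  rw [show -π + 2 * π = π by ring, show x - π + 2 * π = x - -π by ring] at e2
  rw [← e2, hQ, decomp _ (ph_cont ω hω n) hp n hn]
  have e3 : ∫ u in (0 : ℝ)..(π / (2 * n)), Real.sin (n * u) *
      ∑ k ∈ Finset.range (2 * n), (-1 : ℝ) ^ k * (ph ω n (k * π / n + u) - ph ω n (k * π / n - u)) =
      ∫ u in (0 : ℝ)..(π / (2 * n)), (2 * n : ℝ) * (Real.sin (n * u) * ω (2 * u)) := by
    refine intervalIntegral.integral_congr fun u hu => ?_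
    rw [Set.uIcc_of_le (by positivity)] at hu
    rw [Finset.sum_congr rfl (g := fun _ => ω (2 * u))]
    · rw [Finset.sum_const, Finset.card_range, nsmul_eq_mul]; push_cast; ring
    · intro k _
      rw [show k * π / n + u = u + k * (π / n) by ring, show k * π / n - u = -u + k * (π / n) by ring,
        hA.add_nat_mul_eq, hA.add_nat_mul_eq, ph_neg, ph_val ω hω n hn u hu.1 hu.2]
      have : ((-1 : ℝ) ^ k) * (-1) ^ k = 1 := by rw [← mul_pow]; simp
      linear_combination (ω (2 * u)) * this
  rw [e3, intervalIntegral.integral_const_mul, eN_eq ω n hn]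
  field_simp

lemma EnC_ge (n : ℕ) (hn : 0 < n) (f : ℝ → ℝ) (hf : Continuous f) (h : Function.Antiperiodic f (π / n)) (x : ℝ) :
    |f x| ≤ EnC n f := by
  have hn' : (0 : ℝ) < n := by exact_mod_cast hn
  have hp := anti_per f n hn h
  unfold EnC
  apply le_csInf
  · exact ⟨_, fun _ => 0, ⟨fun _ => 0, fun _ => 0, fun x => by simp⟩, rfl⟩
  rintro e ⟨T, ⟨a, b, hT⟩, rfl⟩
  have hTc : Continuous T := by
    rw [show T = _ from funext hT]; fun_prop
  have hTp : Function.Periodic T (2 * π) := by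
    intro t
    rw [hT, hT]
    refine Finset.sum_congr rfl fun k _ => ?_
    rw [show (k : ℝ) * (t + 2 * π) = k * t + k * (2 * π) by ring, Real.cos_add_nat_mul_two_pi, Real.sin_add_nat_mul_two_pi]
  have hgc : Continuous fun y => |f y - T y| := by fun_prop
  have hgp : Function.Periodic (fun y => |f y - T y|) (2 * π) := by
    intro t; simp only; rw [hp t, hTp t]
  have hbd : BddAbove (Set.range fun y => |f y - T y|) :=
    (hgp.isBounded_of_continuous (by positivity) hgc).bddAbove
  have hT0 : ∑ j ∈ Finset.range (2 * n), (-1 : ℝ) ^ j * T (x + j * π / n) = 0 := by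
    have e : ∀ j : ℕ, (-1 : ℝ) ^ j * T (x + j * π / n) = ∑ k ∈ Finset.range n,
      (a k * ((-1) ^ j * Real.cos ((k : ℤ) * (x + j * π / n) - 0)) + b k * ((-1) ^ j * Real.cos ((k : ℤ) * (x + j * π / n) - π / 2))) := by
      intro j
      rw [hT, Finset.mul_sum]
      refine Finset.sum_congr rfl fun k _ => ?_
      rw [Real.cos_sub_pi_div_two, sub_zero]
      push_cast; ring
    rw [Finset.sum_congr rfl fun j _ => e j, Finset.sum_comm]
    refine Finset.sum_eq_zero fun k hk => ?_
    have hk' := Finset.mem_range.1 hk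
    have hd : ¬ ((2 * n : ℤ) ∣ (k : ℤ) + n) := by
      rintro ⟨c, hc⟩
      have c1 : 0 < c := by by_contra hh; push Not at hh; nlinarith
      have c2 : c < 1 := by by_contra hh; push Not at hh; nlinarith
      omega
    rw [Finset.sum_add_distrib, ← Finset.mul_sum, ← Finset.mul_sum, alias_alt_cos n hn _ hd, alias_alt_cos n hn _ hd]
    simp
  have hF : (2 * n : ℝ) * f x = ∑ j ∈ Finset.range (2 * n), (-1 : ℝ) ^ j * (f (x + j * π / n) - T (x + j * π / n)) := by
    simp_rw [mul_sub]
    rw [Finset.sum_sub_distrib, hT0, sub_zero, Finset.sum_congr rfl (g := fun _ => f x)]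
    · rw [Finset.sum_const, Finset.card_range, nsmul_eq_mul]; push_cast; ring
    · intro j _
      rw [show x + j * π / n = x + j * (π / n) by ring, h.add_nat_mul_eq]
      have : ((-1 : ℝ) ^ j) * (-1) ^ j = 1 := by rw [← mul_pow]; simp
      linear_combination f x * this
  have : (2 * n : ℝ) * |f x| ≤ (2 * n : ℝ) * ⨆ y, |f y - T y| := by
    rw [← abs_of_pos (by positivity : (0 : ℝ) < 2 * n), ← abs_mul, abs_of_pos (by positivity : (0 : ℝ) < 2 * n), hF]
    refine (Finset.abs_sum_le_sum_abs _ _).trans ?_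
    refine (Finset.sum_le_card_nsmul _ _ (⨆ y, |f y - T y|) fun j _ => ?_).trans (le_of_eq ?_)
    · rw [abs_mul, abs_pow, abs_neg, abs_one, one_pow, one_mul]
      exact le_ciSup hbd (x + j * π / n)
    · rw [Finset.card_range, nsmul_eq_mul]; push_cast; ring
  exact le_of_mul_le_mul_left this (by positivity)

lemma lower (ψ : ℝ → ℝ) (n : ℕ) (hn : 0 < n) (hψ : PsiOK ψ n) (β : ℝ) (ω : ℝ → ℝ) (hω : IsModulus ω)
    (hc : ConcaveOn ℝ (Set.Ici 0) ω) : ∃ f ∈ CClass ψ β ω,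
    (2 / π) * ψ n * eN n ω - 6 * ω (1 / n) * ∑' k : ℕ, ψ ((k + 2 * n : ℕ) + 1) ≤ EnC n f := by
  have hn' : (0 : ℝ) < n := by exact_mod_cast hn
  have hpi := Real.pi_pos
  have hA := ph_anti ω n hn
  have hp := anti_per _ n hn hA
  have hcont := ph_cont ω hω n
  have hK := PsiKer_cont hψ β
  set f : ℝ → ℝ := fun x => 0 / 2 + (1 / π) * ∫ t in (-π)..π, ph ω n (x - t) * PsiKer ψ β t with hf
  have hfc : Continuous f := by
    rw [hf]
    refine continuous_const.add (continuous_const.mul ?_)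
    apply intervalIntegral.continuous_parametric_intervalIntegral_of_continuous'
    simp only [Function.uncurry_def]
    fun_prop
  have hfa : Function.Antiperiodic f (π / n) := by
    intro x
    simp only [hf]
    rw [← intervalIntegral.integral_congr (f := fun t => -(ph ω n (x - t) * PsiKer ψ β t)), intervalIntegral.integral_neg]
    · ring
    · intro t _
      simp only
      rw [show x + π / n - t = (x - t) + π / n by ring, hA]; ring
  refine ⟨f, ⟨hfc, anti_per f n hn hfa, 0, ph ω n, hcont, hp, anti_mean _ n hn hA, ph_mod ω hω hc n hn, fun x => rfl⟩, ?_⟩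
  set θ := β * π / 2 with hθ
  set x := (θ + π / 2) / n with hx
  refine le_trans ?_ ((le_abs_self _).trans (EnC_ge n hn f hfc hfa x))
  set R := ∑' k : ℕ, ψ ((k + 2 * n : ℕ) + 1) with hR
  set S : ℝ → ℝ := fun t => ∑ k ∈ Finset.range (2 * n), ψ (k + 1) * Real.cos ((k + 1) * t - θ) with hS
  have hSc : Continuous S := by rw [hS]; fun_prop
  have hSI : ∫ t in (-π)..π, ph ω n (x - t) * S t = ψ n * (2 * eN n ω) := by
    have e1 : ∀ t, ph ω n (x - t) * S t = ∑ k ∈ Finset.range (2 * n), ψ (k + 1) * (ph ω n (x - t) * Real.cos ((k + 1 : ℕ) * t - θ)) := by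
      intro t
      simp only [hS]
      rw [Finset.mul_sum]
      refine Finset.sum_congr rfl fun k _ => ?_
      push_cast; ring
    simp_rw [e1]
    rw [intervalIntegral.integral_finsetSum]
    · simp_rw [intervalIntegral.integral_const_mul]
      rw [Finset.sum_eq_single (n - 1)]
      · have : ((n - 1 : ℕ) : ℝ) + 1 = n := by rw [Nat.cast_sub (by omega)]; simp
        rw [this, show n - 1 + 1 = n by omega, hx, ph_main ω hω n hn θ]
      · intro k hk hk'
        have := Finset.mem_range.1 hk
        rw [anti_orth _ hcont n hn hA (k + 1) (by omega) (by omega) (by omega), mul_zero]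
      · intro h; exfalso; apply h; rw [Finset.mem_range]; omega
    · intro k _
      exact Continuous.intervalIntegrable (by fun_prop) _ _
  have hE : |∫ t in (-π)..π, (ph ω n (x - t) * PsiKer ψ β t - ph ω n (x - t) * S t)| ≤ 3 * ω (1 / n) * R * |π - -π| := by
    rw [← Real.norm_eq_abs]
    apply intervalIntegral.norm_integral_le_of_norm_le_const
    intro t _
    rw [← mul_sub, Real.norm_eq_abs, abs_mul]
    have h1 := PsiKer_tail hψ β t (2 * n)
    exact mul_le_mul (ph_bd ω hω n hn _) h1 (abs_nonneg _) ((abs_nonneg _).trans (ph_bd ω hω n hn 0))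
  rw [intervalIntegral.integral_sub (Continuous.intervalIntegrable (by fun_prop) _ _) (Continuous.intervalIntegrable (by fun_prop) _ _), hSI,
    abs_of_pos (by linarith : 0 < π - -π)] at hE
  have h3 := (abs_le.1 hE).1
  simp only [hf]
  set I := ∫ t in (-π)..π, ph ω n (x - t) * PsiKer ψ β t
  have : (1 / π) * (ψ n * (2 * eN n ω) - 3 * ω (1 / n) * R * (π - -π)) ≤ (1 / π) * I := by
    apply mul_le_mul_of_nonneg_left _ (by positivity); linarith
  refine le_trans (le_of_eq ?_) (this.trans (by simp))
  field_simp
  ring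


lemma psi_pos (δ α r t : ℝ) (ht : 0 < t) : 0 < psiDAR δ α r t := by
  unfold psiDAR; positivity

lemma psi_nn (δ α r t : ℝ) (ht : 0 ≤ t) : 0 ≤ psiDAR δ α r t := by
  unfold psiDAR; positivity

lemma psi_ratio (δ α r : ℝ) (hδ : 0 ≤ δ) (a b : ℝ) (ha : 0 < a) (hab : a ≤ b) :
    psiDAR δ α r b ≤ psiDAR δ α r a * Real.exp (-α * (b ^ r - a ^ r)) := by
  unfold psiDAR
  rw [mul_assoc, ← Real.exp_add, show -α * a ^ r + -α * (b ^ r - a ^ r) = -α * b ^ r by ring]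
  exact mul_le_mul_of_nonneg_right (Real.rpow_le_rpow_of_nonpos ha hab (by linarith)) (Real.exp_pos _).le

lemma exp_poly (a r : ℝ) (ha : 0 < a) (hr : 0 < r) : ∃ C : ℝ, 0 < C ∧ ∀ x : ℝ, 1 ≤ x → Real.exp (-a * x ^ r) ≤ C / x ^ 4 := by
  obtain ⟨N, hN⟩ := exists_nat_ge (4 / r)
  refine ⟨N.factorial / a ^ N, by positivity, fun x hx => ?_⟩
  have hx0 : 0 < x := by linarith
  have h1 := Real.pow_div_factorial_le_exp (a * x ^ r) (by positivity) N
  have h2 : x ^ 4 ≤ (x ^ r) ^ N := by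
    rw [← Real.rpow_natCast (x ^ r), ← Real.rpow_mul hx0.le, ← Real.rpow_natCast x 4]
    apply Real.rpow_le_rpow_of_exponent_le hx
    rw [div_le_iff₀ hr] at hN
    push_cast; linarith
  rw [neg_mul, Real.exp_neg, div_div, inv_eq_one_div, div_le_div_iff₀ (by positivity) (by positivity), one_mul]
  rw [div_le_iff₀ (by positivity), mul_pow] at h1
  have : a ^ N * x ^ 4 ≤ a ^ N * (x ^ r) ^ N := by gcongr
  linarith

lemma rpow_diff_ge (r : ℝ) (hr : 1 ≤ r) (a b : ℝ) (ha : 0 < a) (hab : a ≤ b) :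
    r * a ^ (r - 1) * (b - a) ≤ b ^ r - a ^ r := by
  have h := one_add_mul_self_le_rpow_one_add (s := (b - a) / a) (by
    have : 0 ≤ (b - a) / a := div_nonneg (by linarith) ha.le
    linarith) hr
  rw [show 1 + (b - a) / a = b / a by field_simp; ring, Real.div_rpow (by linarith) ha.le, le_div_iff₀ (by positivity)] at h
  rw [Real.rpow_sub_one ha.ne']
  have : r * (a ^ r / a) * (b - a) = r * ((b - a) / a) * a ^ r := by ring
  rw [this]; linarith

lemma rpow_diff_le (r : ℝ) (hr0 : 0 ≤ r) (hr : r ≤ 1) (a b : ℝ) (ha : 0 < a) (hab : a ≤ b) :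
    r * b ^ (r - 1) * (b - a) ≤ b ^ r - a ^ r := by
  have hb : 0 < b := by linarith
  have h := rpow_one_add_le_one_add_mul_self (s := -((b - a) / b)) (by
    have : (b - a) / b ≤ 1 := (div_le_one hb).2 (by linarith)
    linarith) hr0 hr
  rw [show 1 + -((b - a) / b) = a / b by field_simp; ring, Real.div_rpow ha.le hb.le, div_le_iff₀ (by positivity)] at h
  rw [Real.rpow_sub_one hb.ne']
  have : r * (b ^ r / b) * (b - a) = r * ((b - a) / b) * b ^ r := by ring
  rw [this]; linarith

lemma psi_le_pow (δ α r : ℝ) (hδ : 0 ≤ δ) (x : ℝ) (hx : 1 ≤ x) : psiDAR δ α r x ≤ Real.exp (-α * x ^ r) := by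
  unfold psiDAR
  have : x ^ (-δ) ≤ 1 := Real.rpow_le_one_of_one_le_of_nonpos hx (by linarith)
  exact mul_le_of_le_one_left (by positivity) this

lemma psi_summ (δ α r : ℝ) (hδ : 0 ≤ δ) (hα : 0 < α) (hr : 0 < r) : Summable fun k : ℕ => psiDAR δ α r (k + 1) := by
  obtain ⟨C, hC, h⟩ := exp_poly α r hα hr
  have hs : Summable fun k : ℕ => C * (1 / ((k + 1 : ℕ) : ℝ) ^ 4) :=
    ((summable_nat_add_iff 1).2 (Real.summable_one_div_nat_pow.2 (by norm_num : 1 < 4))).mul_left C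
  refine Summable.of_nonneg_of_le (fun k => psi_nn _ _ _ _ (by positivity)) (fun k => ?_) hs
  have h1 : (1 : ℝ) ≤ k + 1 := by have : (0 : ℝ) ≤ k := k.cast_nonneg; linarith
  refine (psi_le_pow δ α r hδ _ h1).trans ((h _ h1).trans (le_of_eq ?_))
  push_cast; ring

lemma psi_antitone (δ α r : ℝ) (hδ : 0 ≤ δ) (hα : 0 < α) (hr : 0 < r) (a b : ℝ) (ha : 0 < a) (hab : a ≤ b) :
    psiDAR δ α r b ≤ psiDAR δ α r a := by
  refine (psi_ratio δ α r hδ a b ha hab).trans ?_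
  have h1 : a ^ r ≤ b ^ r := Real.rpow_le_rpow ha.le hab hr.le
  have h2 : Real.exp (-α * (b ^ r - a ^ r)) ≤ 1 := Real.exp_le_one_iff.2 (by nlinarith)
  exact mul_le_of_le_one_right (psi_nn _ _ _ _ ha.le) h2

lemma psi_conv_le (δ α r : ℝ) (hδ : 0 ≤ δ) (hα : 0 < α) (hr : 0 < r) (hr1 : r ≤ 1) (t : ℝ) (ht : 0 < t) :
    0 ≤ psiDAR δ α r t - 2 * psiDAR δ α r (t + 1) + psiDAR δ α r (t + 2) := by
  have e : ∀ s : ℝ, 0 < s → psiDAR δ α r s = Real.exp (-δ * Real.log s - α * s ^ r) := by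
    intro s hs
    unfold psiDAR
    rw [Real.rpow_def_of_pos hs, ← Real.exp_add]
    congr 1; ring
  rw [e t ht, e (t + 1) (by linarith), e (t + 2) (by linarith)]
  have h1 := strictConcaveOn_log_Ioi.concaveOn.2 (Set.mem_Ioi.2 ht) (Set.mem_Ioi.2 (by linarith : 0 < t + 2))
    (by norm_num : (0 : ℝ) ≤ 1 / 2) (by norm_num : (0 : ℝ) ≤ 1 / 2) (by norm_num)
  have h2 := (Real.concaveOn_rpow hr.le hr1).2 (Set.mem_Ici.2 ht.le) (Set.mem_Ici.2 (by linarith : 0 ≤ t + 2))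
    (by norm_num : (0 : ℝ) ≤ 1 / 2) (by norm_num : (0 : ℝ) ≤ 1 / 2) (by norm_num)
  simp only [smul_eq_mul] at h1 h2
  rw [show 1 / 2 * t + 1 / 2 * (t + 2) = t + 1 by ring] at h1 h2
  set A := -δ * Real.log t - α * t ^ r
  set B := -δ * Real.log (t + 2) - α * (t + 2) ^ r
  have h3 : -δ * Real.log (t + 1) - α * (t + 1) ^ r ≤ 1 / 2 * A + 1 / 2 * B := by
    have := mul_le_mul_of_nonneg_left h1 hδ
    have := mul_le_mul_of_nonneg_left h2 hα.le
    simp only [A, B]; linarith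
  have h4 := convexOn_exp.2 (Set.mem_univ A) (Set.mem_univ B)
    (by norm_num : (0 : ℝ) ≤ 1 / 2) (by norm_num : (0 : ℝ) ≤ 1 / 2) (by norm_num)
  simp only [smul_eq_mul] at h4
  have h5 := Real.exp_le_exp.2 h3
  linarith

lemma psi_conv_gt (δ α r : ℝ) (hδ : 0 ≤ δ) (hα : 0 < α) (hr1 : 1 ≤ r) (t : ℝ) (ht : 0 < t)
    (hbig : 1 ≤ α * r * t ^ (r - 1)) :
    0 ≤ psiDAR δ α r t - 2 * psiDAR δ α r (t + 1) + psiDAR δ α r (t + 2) := by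
  have h1 := psi_ratio δ α r hδ t (t + 1) ht (by linarith)
  have h2 := rpow_diff_ge r hr1 t (t + 1) ht (by linarith)
  rw [show t + 1 - t = 1 by ring, mul_one] at h2
  have h3 : -α * ((t + 1) ^ r - t ^ r) ≤ -1 := by
    have := mul_le_mul_of_nonneg_left h2 hα.le
    linarith
  have h4 : Real.exp (-α * ((t + 1) ^ r - t ^ r)) ≤ 1 / 2 := by
    refine (Real.exp_le_exp.2 h3).trans ?_
    rw [Real.exp_neg, inv_eq_one_div]
    apply one_div_le_one_div_of_le (by norm_num)
    have := Real.add_one_le_exp (1 : ℝ); linarith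
  have h5 := psi_nn δ α r (t + 2) (by linarith)
  have h6 := psi_pos δ α r t ht
  have := mul_le_mul_of_nonneg_left h4 h6.le
  linarith

lemma psi_OK (δ α r : ℝ) (hδ : 0 ≤ δ) (hα : 0 < α) (hr : 0 < r) : ∃ n₀ : ℕ, ∀ n : ℕ, n₀ ≤ n → PsiOK (psiDAR δ α r) n := by
  have hmain : ∃ n₀ : ℕ, 1 ≤ n₀ ∧ ∀ k : ℕ, n₀ ≤ k →
      0 ≤ psiDAR δ α r k - 2 * psiDAR δ α r (k + 1) + psiDAR δ α r (k + 2) := by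
    rcases le_or_gt r 1 with h | h
    · exact ⟨1, le_rfl, fun k hk => psi_conv_le δ α r hδ hα hr h k (by exact_mod_cast hk)⟩
    · have ht : Tendsto (fun k : ℕ => α * r * (k : ℝ) ^ (r - 1)) atTop atTop :=
        ((tendsto_rpow_atTop (by linarith : 0 < r - 1)).comp tendsto_natCast_atTop_atTop).const_mul_atTop (by positivity)
      obtain ⟨n₁, h₁⟩ := eventually_atTop.1 (ht.eventually_ge_atTop 1)
      refine ⟨n₁ + 1, by omega, fun k hk => ?_⟩
      have : 0 < k := by omega
      exact psi_conv_gt δ α r hδ hα h.le k (by exact_mod_cast this) (h₁ k (by omega))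
  obtain ⟨n₀, h1, hm⟩ := hmain
  refine ⟨n₀, fun n hn => ⟨psi_summ δ α r hδ hα hr, fun k => psi_nn _ _ _ _ k.cast_nonneg, fun k hk => ?_, fun k hk => hm k (by omega)⟩⟩
  have : 0 < k := by omega
  exact psi_antitone δ α r hδ hα hr _ _ (by exact_mod_cast this) (by linarith)

lemma psi_geo (ψ : ℝ → ℝ) (n m : ℕ) (q : ℝ) (hq0 : 0 < q) (hq1 : q < 1) (hψ : 0 ≤ ψ n)
    (h : ∀ j : ℕ, j < m → ψ (n + j : ℕ) ≤ ψ n * q ^ j) :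
    ∑ j ∈ Finset.Ico 1 m, ψ (n + j : ℕ) ≤ ψ n * (q / (1 - q)) := by
  have h1 : 0 < 1 - q := by linarith
  rcases le_or_gt m 1 with hm | hm
  · rw [Finset.Ico_eq_empty (by omega)]
    simp only [Finset.sum_empty]; positivity
  · calc _ ≤ ∑ j ∈ Finset.Ico 1 m, ψ n * q ^ j := Finset.sum_le_sum fun j hj => h j (Finset.mem_Ico.1 hj).2
      _ = ψ n * ((q ^ m - q ^ 1) / (q - 1)) := by rw [← Finset.mul_sum, geom_sum_Ico hq1.ne hm.le]
      _ = ψ n * ((q - q ^ m) / (1 - q)) := by rw [pow_one, ← neg_div_neg_eq, neg_sub, neg_sub]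
      _ ≤ _ := by
        gcongr
        have : 0 < q ^ m := by positivity
        linarith

/-- The quantitative facts, `r ≥ 1`. -/
lemma quant_ge (δ α r : ℝ) (hδ : 0 ≤ δ) (hα : 0 < α) (hr : 1 ≤ r) : ∃ C : ℝ, 0 < C ∧ ∀ n : ℕ, 4 ≤ n →
    (∑ j ∈ Finset.Ico 1 (n / 2), psiDAR δ α r (n + j : ℕ) ≤ C * n * gammaAR α r n * psiDAR δ α r n) ∧
    n * (∑' k : ℕ, psiDAR δ α r ((k + (n - 1 + n / 2) : ℕ) + 1) + (n / 2 : ℕ) * psiDAR δ α r (n + n / 2 : ℕ)) ≤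
      C * psiDAR δ α r n * gammaAR α r n := by
  set q₀ := Real.exp (-α * r) with hq₀
  have hr0 : 0 < r := by linarith
  have hq₀0 : 0 < q₀ := Real.exp_pos _
  have hq₀1 : q₀ < 1 := Real.exp_lt_one_iff.2 (by nlinarith)
  obtain ⟨D, hD⟩ := (tendsto_pow_const_mul_const_pow_of_lt_one 3 hq₀0.le hq₀1).bddAbove_range
  have hD' : ∀ i : ℕ, (i : ℝ) ^ 3 * q₀ ^ i ≤ D := fun i => hD ⟨i, rfl⟩
  have hD0 : 0 ≤ D := by simpa using hD' 0
  have hq1' : 0 < 1 - q₀ := by linarith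
  set c := 1 / (1 - q₀) with hc
  have hc0 : 0 < c := by positivity
  refine ⟨c + 125 * (c + 1) * D, by positivity, fun n hn => ?_⟩
  have hn0 : (0 : ℝ) < n := by exact_mod_cast (by omega : 0 < n)
  have hn1 : (1 : ℝ) ≤ n := by exact_mod_cast (by omega : 1 ≤ n)
  set q := Real.exp (-α * r * (n : ℝ) ^ (r - 1)) with hq
  have hq0 : 0 < q := Real.exp_pos _
  have hqq : q ≤ q₀ := by
    apply Real.exp_le_exp.2
    have : 1 ≤ (n : ℝ) ^ (r - 1) := Real.one_le_rpow hn1 (by linarith)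
    have : 0 < α * r := by positivity
    nlinarith
  have hP := psi_pos δ α r n hn0
  set P := psiDAR δ α r n with hPd
  have hgam : q ≤ n * gammaAR α r n := by
    unfold gammaAR
    rw [if_neg (by linarith)]
    split_ifs with h
    · subst h
      rw [hq]
      simp only [sub_self, Real.rpow_zero, mul_one]
      rw [mul_div_cancel₀ _ hn0.ne']
      have : 0 < 1 / α := by positivity
      nlinarith [Real.exp_pos (-α)]
    · rw [mul_div_cancel₀ _ hn0.ne']
  have hgeo : ∀ j : ℕ, psiDAR δ α r (n + j : ℕ) ≤ P * q ^ j := by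
    intro j
    have hj : (0 : ℝ) ≤ j := j.cast_nonneg
    refine (psi_ratio δ α r hδ n (n + j : ℕ) hn0 (by push_cast; linarith)).trans ?_
    apply mul_le_mul_of_nonneg_left _ hP.le
    rw [hq, ← Real.exp_nat_mul]
    apply Real.exp_le_exp.2
    have := rpow_diff_ge r hr n (n + j : ℕ) hn0 (by push_cast; linarith)
    have := mul_le_mul_of_nonneg_left this hα.le
    push_cast at this ⊢
    linarith
  have hq1 : q < 1 := by linarith
  have hqc : 1 / (1 - q) ≤ c := by
    rw [hc]; apply one_div_le_one_div_of_le hq1'; linarith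
  have hG0 : 0 ≤ n * gammaAR α r n := hq0.le.trans hgam
  constructor
  · refine (psi_geo _ n (n / 2) q hq0 hq1 hP.le fun j _ => hgeo j).trans ?_
    have h1 : q / (1 - q) ≤ (n * gammaAR α r n) * (c + 125 * (c + 1) * D) := by
      rw [div_eq_mul_one_div]
      apply mul_le_mul hgam _ (by apply div_nonneg <;> linarith) hG0
      have : 0 ≤ 125 * (c + 1) * D := by positivity
      linarith
    refine (mul_le_mul_of_nonneg_left h1 hP.le).trans (le_of_eq ?_)
    ring
  · set m := n / 2 with hm
    obtain ⟨i, hi⟩ : ∃ i, m = i + 1 := ⟨m - 1, by omega⟩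
    have hi1 : n ≤ 5 * i := by omega
    have hi1' : (n : ℝ) ≤ 5 * i := by exact_mod_cast hi1
    have htail : ∑' k : ℕ, psiDAR δ α r ((k + (n - 1 + m) : ℕ) + 1) ≤ P * q ^ m * c := by
      have hgs : Summable fun k : ℕ => P * q ^ m * q ^ k := (summable_geometric_of_lt_one hq0.le hq1).mul_left _
      have e : ∀ k : ℕ, psiDAR δ α r ((k + (n - 1 + m) : ℕ) + 1) ≤ P * q ^ m * q ^ k := by
        intro k
        have := hgeo (m + k)
        rw [pow_add, ← mul_assoc] at this
        convert this using 2
        rw [show k + (n - 1 + m) = n + (m + k) - 1 by omega, Nat.cast_sub (by omega)]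
        simp
      have hs : Summable fun k : ℕ => psiDAR δ α r ((k + (n - 1 + m) : ℕ) + 1) :=
        Summable.of_nonneg_of_le (fun k => psi_nn _ _ _ _ (by positivity)) e hgs
      refine (hs.tsum_le_tsum e hgs).trans ?_
      rw [tsum_mul_left, tsum_geometric_of_lt_one hq0.le hq1, inv_eq_one_div]
      gcongr
    have hmn : (m : ℝ) ≤ n := by exact_mod_cast (by omega : m ≤ n)
    have h2 := hgeo m
    have hqm : q ^ m ≤ q * q₀ ^ i := by
      rw [hi, pow_succ, mul_comm]; gcongr
    have h3 : n * (∑' k : ℕ, psiDAR δ α r ((k + (n - 1 + m) : ℕ) + 1) + m * psiDAR δ α r (n + m : ℕ)) ≤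
        n * (P * q ^ m * c + n * (P * q ^ m)) := by
      gcongr
      exact psi_nn _ _ _ _ (by positivity)
    have h4 : n * (P * q ^ m * c + n * (P * q ^ m)) ≤ n * P * (c + n) * (q * q₀ ^ i) := by
      have : n * (P * q ^ m * c + n * (P * q ^ m)) = n * P * (c + n) * q ^ m := by ring
      rw [this]; gcongr
    have h5 : (n : ℝ) ^ 2 * (c + n) * q₀ ^ i ≤ 125 * (c + 1) * D := by
      have a1 : (n : ℝ) ^ 2 * (c + n) ≤ (c + 1) * n ^ 3 := by
        have : (n : ℝ) ^ 2 * c * 1 ≤ n ^ 2 * c * n := by gcongr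
        linarith
      have a2 : (n : ℝ) ^ 3 ≤ (5 * i) ^ 3 := by gcongr
      calc (n : ℝ) ^ 2 * (c + n) * q₀ ^ i ≤ (c + 1) * (5 * i) ^ 3 * q₀ ^ i := by
            apply mul_le_mul_of_nonneg_right (a1.trans (by gcongr)) (by positivity)
        _ = 125 * (c + 1) * (i ^ 3 * q₀ ^ i) := by ring
        _ ≤ _ := by gcongr; exact hD' i
    refine h3.trans (h4.trans ?_)
    have h6 : n * P * (c + n) * (q * q₀ ^ i) = P * (q / n) * ((n : ℝ) ^ 2 * (c + n) * q₀ ^ i) := by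
      field_simp
    have hg2 : q / n ≤ gammaAR α r n := by
      rw [div_le_iff₀ hn0]; linarith
    rw [h6]
    have hg0 : 0 ≤ gammaAR α r n := le_trans (by positivity) hg2
    calc P * (q / n) * ((n : ℝ) ^ 2 * (c + n) * q₀ ^ i) ≤ P * gammaAR α r n * (c + 125 * (c + 1) * D) := by
          apply mul_le_mul _ (h5.trans (by linarith)) (by positivity) (by positivity)
          gcongr
      _ = _ := by ring

lemma quant_lt (δ α r : ℝ) (hδ : 0 ≤ δ) (hα : 0 < α) (hr0 : 0 < r) (hr : r < 1) : ∃ C : ℝ, 0 < C ∧ ∀ n : ℕ, 4 ≤ n →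
    (∑ j ∈ Finset.Ico 1 (n / 2), psiDAR δ α r (n + j : ℕ) ≤ C * n * gammaAR α r n * psiDAR δ α r n) ∧
    n * (∑' k : ℕ, psiDAR δ α r ((k + (n - 1 + n / 2) : ℕ) + 1) + (n / 2 : ℕ) * psiDAR δ α r (n + n / 2 : ℕ)) ≤
      C * psiDAR δ α r n * gammaAR α r n := by
  set c := 1 - (3 / 4 : ℝ) ^ r with hc
  have hc0 : 0 < c := by
    have : (3 / 4 : ℝ) ^ r < 1 := Real.rpow_lt_one (by norm_num) (by norm_num) hr0
    linarith
  obtain ⟨D, hD0, hD⟩ := exp_poly (α * c) r (by positivity) hr0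
  set Z := ∑' k : ℕ, 1 / (k : ℝ) ^ 2 with hZ
  have hZs : Summable fun k : ℕ => 1 / (k : ℝ) ^ 2 := Real.summable_one_div_nat_pow.2 (by norm_num)
  have hZ0 : 0 ≤ Z := tsum_nonneg fun k => by positivity
  refine ⟨2 + D * (Z + 1) * (r * α), by positivity, fun n hn => ?_⟩
  have hn0 : (0 : ℝ) < n := by exact_mod_cast (by omega : 0 < n)
  have hn1 : (1 : ℝ) ≤ n := by exact_mod_cast (by omega : 1 ≤ n)
  have hP := psi_pos δ α r n hn0
  set P := psiDAR δ α r n with hPd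
  have hgam : gammaAR α r n = 1 / (r * α * (n : ℝ) ^ r) := by
    unfold gammaAR; rw [if_pos hr]
  have hg0 : 0 < gammaAR α r n := by rw [hgam]; positivity
  have hw : 0 ≤ D * (Z + 1) * (r * α) := by positivity
  constructor
  · set x := α * r * (2 * n : ℝ) ^ (r - 1) with hx
    have hx0 : 0 < x := by positivity
    set q := Real.exp (-x) with hq
    have hq1 : q < 1 := Real.exp_lt_one_iff.2 (by linarith)
    have hgeo : ∀ j : ℕ, j < n / 2 → psiDAR δ α r (n + j : ℕ) ≤ P * q ^ j := by
      intro j hjn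
      have hj : (0 : ℝ) ≤ j := j.cast_nonneg
      have hjn' : (j : ℝ) ≤ n := by exact_mod_cast (by omega : j ≤ n)
      refine (psi_ratio δ α r hδ n (n + j : ℕ) hn0 (by push_cast; linarith)).trans ?_
      apply mul_le_mul_of_nonneg_left _ hP.le
      rw [hq, ← Real.exp_nat_mul]
      apply Real.exp_le_exp.2
      have h1 := rpow_diff_le r hr0.le hr.le n (n + j : ℕ) hn0 (by push_cast; linarith)
      have h2 : (2 * n : ℝ) ^ (r - 1) ≤ ((n + j : ℕ) : ℝ) ^ (r - 1) :=
        Real.rpow_le_rpow_of_nonpos (by positivity) (by push_cast; linarith) (by linarith)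
      have h3 := mul_le_mul_of_nonneg_left h1 hα.le
      have h4 : α * r * j * (2 * n : ℝ) ^ (r - 1) ≤ α * r * j * ((n + j : ℕ) : ℝ) ^ (r - 1) := by gcongr
      push_cast at h3 h4 ⊢
      rw [hx]
      linarith
    refine (psi_geo _ n (n / 2) q (Real.exp_pos _) hq1 hP.le hgeo).trans ?_
    have h1 : q / (1 - q) ≤ 1 / x := by
      rw [div_le_div_iff₀ (by linarith) hx0, one_mul]
      have : x + 1 ≤ Real.exp x := Real.add_one_le_exp x
      have h2 : q * Real.exp x = 1 := by rw [hq, ← Real.exp_add]; simp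
      have := mul_le_mul_of_nonneg_left this (Real.exp_pos (-x)).le
      rw [← hq] at this
      linarith
    have h2 : 1 / x ≤ 2 * (n * gammaAR α r n) := by
      rw [hgam, hx, Real.mul_rpow (by norm_num) hn0.le, Real.rpow_sub_one hn0.ne']
      have h3 : (1 : ℝ) / 2 ≤ 2 ^ (r - 1) := by
        rw [show (1 : ℝ) / 2 = 2 ^ (-1 : ℝ) by rw [Real.rpow_neg_one]; norm_num]
        apply Real.rpow_le_rpow_of_exponent_le (by norm_num); linarith
      rw [div_le_iff₀ (by positivity)]
      have : 2 * (n * (1 / (r * α * (n : ℝ) ^ r))) * (α * r * (2 ^ (r - 1) * ((n : ℝ) ^ r / n))) = 2 * 2 ^ (r - 1) := by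
        field_simp
      rw [this]; linarith
    have h3 : q / (1 - q) ≤ (2 + D * (Z + 1) * (r * α)) * (n * gammaAR α r n) :=
      (h1.trans h2).trans (by gcongr; linarith)
    refine (mul_le_mul_of_nonneg_left h3 hP.le).trans (le_of_eq ?_)
    ring
  · set m := n / 2 with hm
    have hmn : (m : ℝ) ≤ n := by exact_mod_cast (by omega : m ≤ n)
    have h43 : (4 : ℝ) * n ≤ 3 * (n + m : ℕ) := by exact_mod_cast (by omega : 4 * n ≤ 3 * (n + m))
    have hdec : ∀ k : ℕ, n + m ≤ k → psiDAR δ α r k ≤ P * (D / (k : ℝ) ^ 4) := by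
      intro k hk
      have hk' : ((n + m : ℕ) : ℝ) ≤ k := by exact_mod_cast hk
      have hnk : (n : ℝ) ≤ 3 / 4 * k := by linarith
      refine (psi_ratio δ α r hδ n k hn0 (by linarith)).trans ?_
      apply mul_le_mul_of_nonneg_left _ hP.le
      refine le_trans (Real.exp_le_exp.2 ?_) (hD k (by linarith))
      have h1 : (n : ℝ) ^ r ≤ (3 / 4) ^ r * (k : ℝ) ^ r := by
        rw [← Real.mul_rpow (by norm_num) (by positivity)]
        exact Real.rpow_le_rpow hn0.le hnk hr0.le
      have h2 := mul_le_mul_of_nonneg_left h1 hα.le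
      rw [hc]
      linarith
    have htail : ∑' k : ℕ, psiDAR δ α r ((k + (n - 1 + m) : ℕ) + 1) ≤ P * D / n ^ 2 * Z := by
      have hgs : Summable fun k : ℕ => P * D / n ^ 2 * (1 / ((k + (n + m) : ℕ) : ℝ) ^ 2) :=
        ((summable_nat_add_iff (n + m)).2 hZs).mul_left _
      have e : ∀ k : ℕ, psiDAR δ α r ((k + (n - 1 + m) : ℕ) + 1) ≤ P * D / n ^ 2 * (1 / ((k + (n + m) : ℕ) : ℝ) ^ 2) := by
        intro k
        have h1 := hdec (k + (n + m)) (by omega)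
        have e2 : (((k + (n - 1 + m) : ℕ) : ℝ) + 1) = (k + (n + m) : ℕ) := by
          rw [show k + (n - 1 + m) = k + (n + m) - 1 by omega, Nat.cast_sub (by omega)]; simp
        rw [e2]
        refine h1.trans ?_
        have hle : (n : ℝ) ≤ (k + (n + m) : ℕ) := by exact_mod_cast (by omega : n ≤ k + (n + m))
        generalize ((k + (n + m) : ℕ) : ℝ) = y at *
        have hy : 0 < y := by linarith
        rw [← mul_div_assoc, ← mul_div_assoc, mul_one, div_div]
        have : (n : ℝ) ^ 2 * y ^ 2 ≤ y ^ 4 := by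
          have : (n : ℝ) ^ 2 ≤ y ^ 2 := by gcongr
          nlinarith [sq_nonneg y]
        gcongr
      have hs : Summable fun k : ℕ => psiDAR δ α r ((k + (n - 1 + m) : ℕ) + 1) :=
        Summable.of_nonneg_of_le (fun k => psi_nn _ _ _ _ (by positivity)) e hgs
      refine (hs.tsum_le_tsum e hgs).trans ?_
      rw [tsum_mul_left]
      gcongr
      have := hZs.sum_add_tsum_nat_add (n + m)
      have h0 : 0 ≤ ∑ k ∈ Finset.range (n + m), 1 / (k : ℝ) ^ 2 := Finset.sum_nonneg fun k _ => by positivity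
      linarith
    have hone : psiDAR δ α r (n + m : ℕ) ≤ P * D / n ^ 4 := by
      refine (hdec (n + m) le_rfl).trans ?_
      rw [← mul_div_assoc]
      have hle : (n : ℝ) ≤ (n + m : ℕ) := by exact_mod_cast (by omega : n ≤ n + m)
      gcongr
    have h3 : n * (∑' k : ℕ, psiDAR δ α r ((k + (n - 1 + m) : ℕ) + 1) + m * psiDAR δ α r (n + m : ℕ)) ≤
        n * (P * D / n ^ 2 * Z + n * (P * D / n ^ 4)) := by
      gcongr
      exact psi_nn _ _ _ _ (by positivity)
    refine h3.trans ?_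
    have h4 : n * (P * D / n ^ 2 * Z + n * (P * D / n ^ 4)) ≤ P * (D * (Z + 1)) * (1 / n) := by
      have : n * (P * D / n ^ 2 * Z + n * (P * D / n ^ 4)) = P * (D * Z) * (1 / n) + P * D * (1 / n ^ 2) := by
        field_simp
      rw [this]
      have : (1 : ℝ) / n ^ 2 ≤ 1 / n := by
        apply one_div_le_one_div_of_le hn0; nlinarith
      have := mul_le_mul_of_nonneg_left this (by positivity : 0 ≤ P * D)
      linarith
    refine h4.trans ?_
    have h5 : (1 : ℝ) / n ≤ (r * α) * gammaAR α r n := by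
      have e : (r * α) * (1 / (r * α * (n : ℝ) ^ r)) = 1 / (n : ℝ) ^ r := by field_simp
      rw [hgam, e]
      apply one_div_le_one_div_of_le (by positivity)
      calc (n : ℝ) ^ r ≤ (n : ℝ) ^ (1 : ℝ) := Real.rpow_le_rpow_of_exponent_le hn1 hr.le
        _ = n := Real.rpow_one _
    have h6 := mul_le_mul_of_nonneg_left h5 (by positivity : 0 ≤ P * (D * (Z + 1)))
    have h7 : 0 ≤ P * gammaAR α r n := by positivity
    refine h6.trans ?_
    linarith


lemma tail_mono (f : ℕ → ℝ) (hf : Summable f) (h0 : ∀ k, 0 ≤ f k) (a b : ℕ) (hab : a ≤ b) :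
    ∑' k : ℕ, f (k + b) ≤ ∑' k : ℕ, f (k + a) := by
  have hs : Summable fun k => f (k + a) := (summable_nat_add_iff a).2 hf
  have h := hs.sum_add_tsum_nat_add (b - a)
  have h1 : 0 ≤ ∑ k ∈ Finset.range (b - a), f (k + a) := Finset.sum_nonneg fun k _ => h0 _
  have h2 : (fun k => f (k + (b - a) + a)) = fun k => f (k + b) := by
    funext k; congr 1; omega
  rw [h2] at h
  linarith

/-- Corollary 1 (uniform metric): for `ψ(t) = t^{−δ}e^{−αt^r}` and convex `ω`,
`E_n(C^ψ_β H_{ω_C})_C = ψ(n)((2/π) e_n(ω) + O(1) γ_n(α,r) ω(1/n))`. -/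
theorem statement7 (δ α r : ℝ) (hδ : 0 ≤ δ) (hα : 0 < α) (hr : 0 < r) :
    ∃ K : ℝ, 0 < K ∧ ∃ n₀ : ℕ, ∀ β : ℝ, ∀ ω : ℝ → ℝ,
      IsModulus ω → ConcaveOn ℝ (Set.Ici 0) ω → ∀ n : ℕ, n₀ ≤ n →
      |EnCClass n (CClass (psiDAR δ α r) β ω) -
          (2 / π) * psiDAR δ α r n * eN n ω| ≤
        K * psiDAR δ α r n * gammaAR α r n * ω (1 / n) := by
  obtain ⟨n₁, hOK⟩ := psi_OK δ α r hδ hα hr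
  obtain ⟨C, hC, hq⟩ : ∃ C : ℝ, 0 < C ∧ ∀ n : ℕ, 4 ≤ n →
    (∑ j ∈ Finset.Ico 1 (n / 2), psiDAR δ α r (n + j : ℕ) ≤ C * n * gammaAR α r n * psiDAR δ α r n) ∧
    n * (∑' k : ℕ, psiDAR δ α r ((k + (n - 1 + n / 2) : ℕ) + 1) + (n / 2 : ℕ) * psiDAR δ α r (n + n / 2 : ℕ)) ≤
      C * psiDAR δ α r n * gammaAR α r n := by
    rcases lt_or_ge r 1 with h | h
    · exact quant_lt δ α r hδ hα hr h
    · exact quant_ge δ α r hδ hα h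
  refine ⟨24010 * C, by positivity, n₁ + 4, fun β ω hω hc n hn => ?_⟩
  have hψ := hOK n (by omega)
  obtain ⟨hA, hB⟩ := hq n (by omega)
  have hn0 : (0 : ℝ) < n := by exact_mod_cast (by omega : 0 < n)
  have hn1 : (1 : ℝ) ≤ n := by exact_mod_cast (by omega : 1 ≤ n)
  have hw : 0 ≤ ω (1 / n) := hω.2.2.2.2 _ (by positivity)
  set ψ := psiDAR δ α r with hψd
  set γ := gammaAR α r n with hγ
  have hup : ∀ f ∈ CClass ψ β ω, EnC n f ≤ (2 / π) * ψ n * eN n ω + 24010 * C * ψ n * γ * ω (1 / n) := by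
    intro f hf
    refine (upper ψ n (n / 2) (n / 2) hψ (by omega) (by omega) (by omega) (by omega) β ω hω f hf).trans ?_
    have h1 : 24000 * ω (1 / n) * (∑ j ∈ Finset.Ico 1 (n / 2), ψ (n + j : ℕ)) / n ≤
        24000 * ω (1 / n) * (C * n * γ * ψ n) / n := by gcongr
    have h2 : 24000 * ω (1 / n) * (C * n * γ * ψ n) / n = 24000 * C * ψ n * γ * ω (1 / n) := by
      field_simp
    have h3 := mul_le_mul_of_nonneg_left hB (by positivity : 0 ≤ 10 * ω (1 / n))
    linarith
  obtain ⟨f₀, hf₀, hlow⟩ := lower ψ n (by omega) hψ β ω hω hc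
  have hR : ∑' k : ℕ, ψ ((k + 2 * n : ℕ) + 1) ≤ C * ψ n * γ := by
    have h1 := tail_mono (fun k : ℕ => ψ (k + 1)) hψ.summ (fun k => psi_nn _ _ _ _ (by positivity)) (n - 1 + n / 2) (2 * n) (by omega)
    refine h1.trans (le_trans ?_ hB)
    have h2 : 0 ≤ ∑' k : ℕ, ψ ((k + (n - 1 + n / 2) : ℕ) + 1) := tsum_nonneg fun k => psi_nn _ _ _ _ (by positivity)
    have h3 : 0 ≤ (n / 2 : ℕ) * ψ (n + n / 2 : ℕ) := mul_nonneg (by positivity) (psi_nn _ _ _ _ (by positivity))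
    nlinarith
  have hne : (EnC n '' CClass ψ β ω).Nonempty := ⟨_, f₀, hf₀, rfl⟩
  have hbd : BddAbove (EnC n '' CClass ψ β ω) := by
    refine ⟨(2 / π) * ψ n * eN n ω + 24010 * C * ψ n * γ * ω (1 / n), ?_⟩
    rintro _ ⟨f, hf, rfl⟩; exact hup f hf
  have hU : EnCClass n (CClass ψ β ω) ≤ (2 / π) * ψ n * eN n ω + 24010 * C * ψ n * γ * ω (1 / n) := by
    apply csSup_le hne
    rintro _ ⟨f, hf, rfl⟩; exact hup f hf
  have hL : EnC n f₀ ≤ EnCClass n (CClass ψ β ω) := le_csSup hbd ⟨f₀, hf₀, rfl⟩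
  have hR' := mul_le_mul_of_nonneg_left hR (by positivity : 0 ≤ 6 * ω (1 / n))
  have hB0 : 0 ≤ C * ψ n * γ := le_trans (tsum_nonneg fun k => psi_nn _ _ _ _ (by positivity)) hR
  have hB1 := mul_nonneg hB0 hw
  rw [abs_le]
  constructor <;> linarith
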